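/- Let (𝔊,Φ) be a structurally compatible affine cellular automaton of radius 1 on a topological Markov chain 𝔊 which is regular and simple, witnessed by data (𝔽, τ, n, k, ⊗ = ⊗_𝔽 × ⊗_{Σ_n}) and a 1-block topological conjugacy φ between (𝔊,Φ) and (𝔥(𝔽,τ,n), x ↦ x ⊗ σ_𝔥 x). Let μ be a shift-invariant probability measure on 𝔊 with complete connections (compatible with 𝔊) and summable decay. Then the Cesàro mean distribution of μ under Φ converges in the weak-* topology, and its limit is the pushforward under φ^{−1} of a product measure μ_𝔽 × ν on 𝔽 × Σ_n, where μ_𝔽 is a probability measure on 𝔽 invariant under the map f ↦ f ⊗_𝔽 τ(f) and ν is the uniform Bernoulli measure on Σ_n. -/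

import Mathlib

open Filter Topology MeasureTheory
open scoped ENNReal

namespace CAStmt

/-- The shift map on bi-infinite sequences. -/
def shiftMap {G : Type*} (x : ℤ → G) : ℤ → G := fun n => x (n + 1)

/-- The topological Markov chain determined by the transition set `E`. -/
def TMC {G : Type*} (E : Set (G × G)) : Set (ℤ → G) := {x | ∀ i : ℤ, (x i, x (i + 1)) ∈ E}

/-- The word `w` occurs in some point of `X`. -/
def WordIn {G : Type*} (X : Set (ℤ → G)) {m : ℕ} (w : Fin m → G) : Prop :=
  ∃ x ∈ X, ∃ j : ℤ, ∀ i : Fin m, x (j + ((i : ℕ) : ℤ)) = w i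

/-- Every letter of the alphabet occurs in some point of the TMC. -/
def EveryLetterOccurs {G : Type*} (E : Set (G × G)) : Prop :=
  ∀ g : G, ∃ x ∈ TMC E, ∃ i : ℤ, x i = g

/-- The radius-1 cellular automaton map with local rule `φ`. -/
def CA {G : Type*} (φ : G → G → G) (x : ℤ → G) : ℤ → G := fun j => φ (x j) (x (j + 1))

/-- Structural compatibility of the local rule `φ` with the TMC of `E`. -/
def SC {G : Type*} (E : Set (G × G)) (φ : G → G → G) : Prop :=
  ∀ x ∈ TMC E, ∀ y ∈ TMC E, (fun i => φ (x i) (y i)) ∈ TMC E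

def RightPerm {G : Type*} (φ : G → G → G) : Prop := ∀ a, Function.Bijective (φ a)

def LeftPerm {G : Type*} (φ : G → G → G) : Prop := ∀ b, Function.Bijective (fun a => φ a b)

/-- Irreducibility: any two letters are joined by an allowed word `(u,v₁,…,v_k,w)`, `k ≥ 1`. -/
def IrreducibleTMC {G : Type*} (E : Set (G × G)) : Prop :=
  ∀ u w : G, ∃ x ∈ TMC E, ∃ i j : ℤ, i + 1 < j ∧ x i = u ∧ x j = w

/-- Mixing with mixing constant `q`. -/
def MixingTMCWith {G : Type*} (E : Set (G × G)) (q : ℕ) : Prop :=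
  1 ≤ q ∧ ∀ k : ℕ, q ≤ k → ∀ u w : G,
    ∃ x ∈ TMC E, ∃ i : ℤ, x i = u ∧ x (i + (k : ℤ) + 1) = w

def MixingTMC {G : Type*} (E : Set (G × G)) : Prop := ∃ q, MixingTMCWith E q

/-- `Φ` is `N`-scaling on `X`: `(Φ^N x)₀ = φ(x₀, x_N)`. -/
def NScalingOn {G : Type*} (X : Set (ℤ → G)) (φ : G → G → G) (N : ℕ) : Prop :=
  ∀ x ∈ X, (CA φ)^[N] x 0 = φ (x 0) (x (N : ℤ))

/-- The TMC `𝔥(𝔽,τ,n)` over the alphabet `F × Fin n`. -/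
def hTMC {F : Type*} (τ : Equiv.Perm F) (n : ℕ) : Set (ℤ → F × Fin n) :=
  TMC {p : (F × Fin n) × (F × Fin n) | p.2.1 = τ p.1.1}

/-- `op` is a `k`-block operation (memory 0, anticipation `k-1`) closed on `Λ`. -/
def KBlockOp {A : Type*} (Λ : Set (ℤ → A)) (k : ℕ)
    (op : (ℤ → A) → (ℤ → A) → (ℤ → A)) : Prop :=
  (∀ x ∈ Λ, ∀ y ∈ Λ, op x y ∈ Λ) ∧
  ∃ ρ : (Fin k → A) → (Fin k → A) → A,
    ∀ x ∈ Λ, ∀ y ∈ Λ, ∀ j : ℤ,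
      op x y j = ρ (fun i => x (j + ((i : ℕ) : ℤ))) (fun i => y (j + ((i : ℕ) : ℤ)))

/-- `op` is a quasigroup operation on `Λ`: all translations are bijections of `Λ`. -/
def QuasigroupOp {A : Type*} (Λ : Set (ℤ → A)) (op : (ℤ → A) → (ℤ → A) → (ℤ → A)) : Prop :=
  ∀ z ∈ Λ, Set.BijOn (fun x => op x z) Λ Λ ∧ Set.BijOn (fun y => op z y) Λ Λ

/-- A 1-block topological conjugacy between `(X,Φ)` and `(Y,Ψ)` induced by the letter map `θ`. -/
def OneBlockConjugacy {A B : Type*} (X : Set (ℤ → A)) (Φ : (ℤ → A) → (ℤ → A))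
    (Y : Set (ℤ → B)) (Ψ : (ℤ → B) → (ℤ → B)) (θ : A → B) : Prop :=
  Set.BijOn (fun x => θ ∘ x) X Y ∧ ∀ x ∈ X, θ ∘ (Φ x) = Ψ (θ ∘ x)

/-- `add` is an abelian group operation. -/
def IsAbelianGroupOp {K : Type*} (add : K → K → K) : Prop :=
  (∀ a b c, add (add a b) c = add a (add b c)) ∧ (∀ a b, add a b = add b a) ∧
  ∃ z : K, (∀ a, add z a = a) ∧ ∀ a, ∃ b, add a b = z

/-- The product transition set on `K × B`. -/
def prodE {K B : Type*} (EK : Set (K × K)) (EB : Set (B × B)) : Set ((K × B) × (K × B)) :=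
  {p | (p.1.1, p.2.1) ∈ EK ∧ (p.1.2, p.2.2) ∈ EB}

/-- `φK` is an affine local rule for the abelian group operation `add`. -/
def IsAffineRuleExpl {K : Type*} (add : K → K → K) (φK : K → K → K) : Prop :=
  IsAbelianGroupOp add ∧
  ∃ (η ρc : K → K) (c : K), Function.Bijective η ∧ Function.Bijective ρc ∧
    (∀ a b, η (add a b) = add (η a) (η b)) ∧ (∀ a b, ρc (add a b) = add (ρc a) (ρc b)) ∧
    (∀ a, η (ρc a) = ρc (η a)) ∧
    ∀ a b, φK a b = add (add (η a) (ρc b)) c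

/-- The cylinder on the word `w` at coordinates `0,…,m-1`. -/
def cyl {A : Type*} {m : ℕ} (w : Fin m → A) : Set (ℤ → A) :=
  {x | ∀ i : Fin m, x ((i : ℕ) : ℤ) = w i}

/-- A past: `p i` is the letter at coordinate `-(i+1)`; all transitions allowed. -/
def IsPast {A : Type*} (E : Set (A × A)) (p : ℕ → A) : Prop :=
  ∀ i : ℕ, (p (i + 1), p i) ∈ E

/-- The word `(w_{-m},…,w_{-1})` of the past `p`. -/
def pastWord {A : Type*} (p : ℕ → A) (m : ℕ) : Fin m → A :=
  fun j => p (m - 1 - (j : ℕ))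

/-- `μ` has complete connections (compatible with the TMC of `E`) and summable decay. -/
def CCSD {A : Type*} [MeasurableSpace A] (E : Set (A × A)) (μ : Measure (ℤ → A)) : Prop :=
  ∃ ν : (ℕ → A) → A → ℝ,
    (∀ p, IsPast E p → ∀ a, (p 0, a) ∈ E →
      0 < ν p a ∧
      Tendsto (fun m : ℕ =>
          (μ (cyl (Fin.snoc (pastWord p m) a))).toReal / (μ (cyl (pastWord p m))).toReal)
        atTop (nhds (ν p a))) ∧
    ∃ γ : ℕ → ℝ, Summable γ ∧
      ∀ m : ℕ, 1 ≤ m → ∀ p q, IsPast E p → IsPast E q → (∀ i < m, p i = q i) →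
        ∀ a, (p 0, a) ∈ E → |ν p a / ν q a - 1| ≤ γ m

/-- A shift-invariant probability measure carried by the TMC of `E`, positive on allowed
cylinders. -/
def GoodMeasure {A : Type*} [MeasurableSpace A] (E : Set (A × A)) (μ : Measure (ℤ → A)) : Prop :=
  IsProbabilityMeasure μ ∧ Measure.map shiftMap μ = μ ∧ μ (TMC E) = 1 ∧
  ∀ (m : ℕ) (w : Fin m → A), WordIn (TMC E) w → 0 < μ (cyl w)

/-- The identification of `𝔽 × Σ_n` with `𝔥(𝔽,τ,n)`. -/
def ident {F : Type*} (τ : Equiv.Perm F) {n : ℕ} (f : F) (y : ℤ → Fin n) : ℤ → F × Fin n :=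
  fun i => ((τ ^ i) f, y i)

/-- A quasigroup operation on an alphabet. -/
def QuasigroupPointOp {K : Type*} (o : K → K → K) : Prop :=
  ∀ a, Function.Bijective (fun x => o x a) ∧ Function.Bijective (o a)

/-- The data witnessing that an SC bipermutative c.a. is regular and simple. -/
def RegularSimpleData {K F : Type*} (EK : Set (K × K)) (φK : K → K → K)
    (τ : Equiv.Perm F) (n k : ℕ)
    (op : (ℤ → F × Fin n) → (ℤ → F × Fin n) → (ℤ → F × Fin n))
    (θ : K → F × Fin n) (oF : F → F → F) (oS : Fin n → Fin n → Fin n) : Prop :=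
  1 ≤ n ∧ 1 ≤ k ∧
  KBlockOp (hTMC τ n) k op ∧ QuasigroupOp (hTMC τ n) op ∧
  OneBlockConjugacy (TMC EK) (CA φK) (hTMC τ n) (fun x => op x (shiftMap x)) θ ∧
  QuasigroupPointOp oF ∧ QuasigroupPointOp oS ∧
  ∀ (f g : F) (y z : ℤ → Fin n),
    op (ident τ f y) (ident τ g z) = ident τ (oF f g) (fun i => oS (y i) (z i))

/-- An SC bipermutative c.a. is regular and simple. -/
def RegularSimple {K : Type*} (EK : Set (K × K)) (φK : K → K → K) : Prop :=
  ∃ (F : Type) (_ : Fintype F) (τ : Equiv.Perm F) (n k : ℕ)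
    (op : (ℤ → F × Fin n) → (ℤ → F × Fin n) → (ℤ → F × Fin n))
    (θ : K → F × Fin n) (oF : F → F → F) (oS : Fin n → Fin n → Fin n),
    RegularSimpleData EK φK τ n k op θ oF oS

/-- Weak-* convergence of the Cesàro means of `μ` under `Φ` to `κ`. -/
def CesaroTendstoTo {G : Type*} [TopologicalSpace G] [MeasurableSpace G]
    (μ : Measure (ℤ → G)) (Φ : (ℤ → G) → (ℤ → G)) (κ : Measure (ℤ → G)) : Prop :=
  ∀ f : C(ℤ → G, ℝ), Tendsto
    (fun N : ℕ => (N : ℝ)⁻¹ * ∑ n ∈ Finset.range N, ∫ x, f (Φ^[n] x) ∂μ)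
    atTop (nhds (∫ x, f x ∂κ))

/-- `κ` is the Parry measure of the irreducible TMC of `E`. -/
def IsParryMeasure {G : Type*} [Fintype G] [MeasurableSpace G] (E : Set (G × G))
    (κ : Measure (ℤ → G)) : Prop :=
  IsProbabilityMeasure κ ∧ Measure.map shiftMap κ = κ ∧
  ∃ (lam : ℝ) (r l : G → ℝ), 0 < lam ∧ (∀ a, 0 < r a) ∧ (∀ a, 0 < l a) ∧
    (∀ a : G, (∑ b : G, E.indicator (fun _ => r b) (a, b)) = lam * r a) ∧
    (∀ b : G, (∑ a : G, E.indicator (fun _ => l a) (a, b)) = lam * l b) ∧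
    (∑ a : G, l a * r a) = 1 ∧
    ∀ (m : ℕ) (w : Fin (m + 1) → G), WordIn (TMC E) w →
      (κ (cyl w)).toReal = l (w 0) * r (w (Fin.last m)) / lam ^ m

/-- Entropy of the refinement `P ∨ T⁻¹P ∨ ⋯ ∨ T^{-(n-1)}P`. -/
noncomputable def joinEntropy {X : Type*} [MeasurableSpace X] (μ : Measure X) (T : X → X)
    {r : ℕ} (P : Fin r → Set X) (n : ℕ) : ℝ :=
  -∑ c : Fin n → Fin r,
      ((μ (⋂ i : Fin n, T^[(i : ℕ)] ⁻¹' P (c i))).toReal *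
        Real.log (μ (⋂ i : Fin n, T^[(i : ℕ)] ⁻¹' P (c i))).toReal)

/-- The Kolmogorov–Sinai entropy `h_μ(T)` is positive: some finite measurable partition has
positive entropy. -/
def KSEntropyPos {X : Type*} [MeasurableSpace X] (μ : Measure X) (T : X → X) : Prop :=
  ∃ (r : ℕ) (P : Fin r → Set X), (∀ i, MeasurableSet (P i)) ∧
    Pairwise (Function.onFun Disjoint P) ∧ (⋃ i, P i) = Set.univ ∧
    0 < Filter.liminf (fun n : ℕ => joinEntropy μ T P n / n) Filter.atTop

end CAStmt
namespace CAProof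
open Filter Topology MeasureTheory CAStmt
open scoped ENNReal

/-- The partial sums of `f` grow sublinearly (one-sided bound). -/
def CesaroNull (f : ℕ → ℝ) : Prop :=
  ∀ ε > 0, ∃ C : ℝ, ∀ n : ℕ, ∑ m ∈ Finset.range n, f m ≤ C + ε * n

theorem CesaroNull.of_le {f g : ℕ → ℝ} (hg : CesaroNull g) (h : ∀ n, f n ≤ g n) :
    CesaroNull f := fun ε hε =>
  (hg ε hε).imp fun _ hC n => (Finset.sum_le_sum fun m _ => h m).trans (hC n)

theorem CesaroNull.const_mul {f : ℕ → ℝ} (hf : CesaroNull f) {c : ℝ} (hc : 0 < c) :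
    CesaroNull fun n => c * f n := fun ε hε => by
  obtain ⟨C, hC⟩ := hf (ε / c) (by positivity)
  refine ⟨c * C, fun n => ?_⟩
  rw [← Finset.mul_sum]
  calc _ ≤ c * (C + ε / c * n) := mul_le_mul_of_nonneg_left (hC n) hc.le
    _ = _ := by field_simp

theorem sum_range_mul_eq (f : ℕ → ℝ) (D q : ℕ) :
    ∑ m ∈ Finset.range (D * q), f m
      = ∑ i ∈ Finset.range q, ∑ d ∈ Finset.range D, f (D * i + d) := by
  induction q with
  | zero => simp
  | succ q ih => rw [Nat.mul_succ, Finset.sum_range_add, ih, Finset.sum_range_succ]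

theorem sum_range_le_blocks {f : ℕ → ℝ} (hf0 : ∀ m, 0 ≤ f m) {D : ℕ} (hD : 0 < D) (n : ℕ) :
    ∑ m ∈ Finset.range n, f m
      ≤ ∑ i ∈ Finset.range (n / D + 1), ∑ d ∈ Finset.range D, f (D * i + d) := by
  rw [← sum_range_mul_eq]
  refine Finset.sum_le_sum_of_subset_of_nonneg ?_ fun _ _ _ => hf0 _
  exact Finset.range_subset_range.2 (Nat.lt_mul_div_succ n hD).le

/-- A bounded sequence which is small on most of each block, up to a Cesàro-null error depending
on the block only, is Cesàro-null. -/
theorem cesaroNull_of_blocks {f : ℕ → ℝ} (hf0 : ∀ m, 0 ≤ f m) (hf1 : ∀ m, f m ≤ 1)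
    (h : ∀ ε > 0, ∃ (D W : ℕ) (v : ℕ → ℝ), 0 < D ∧ (W : ℝ) ≤ ε * D ∧ (∀ q, 0 ≤ v q) ∧
      CesaroNull v ∧ ∀ q d, d + W < D → f (D * q + d) ≤ ε + v q) : CesaroNull f := by
  intro ε hε
  obtain ⟨D, W, v, hD, hW, hv0, hv, hfv⟩ := h (ε / 3) (by positivity)
  obtain ⟨C, hC⟩ := hv (ε / 3) (by positivity)
  have hD' : (0 : ℝ) < D := by exact_mod_cast hD
  have block : ∀ q, ∑ d ∈ Finset.range D, f (D * q + d) ≤ 2 * (ε / 3) * D + D * v q := by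
    intro q
    have hle : ∀ d ∈ Finset.range D,
        f (D * q + d) ≤ (ε / 3 + v q) + if D ≤ d + W then 1 else 0 := by
      intro d _
      split_ifs with hd
      · have := hf1 (D * q + d); have := hv0 q; linarith
      · have := hfv q d (by omega); linarith
    have hcard : ∑ d ∈ Finset.range D, (if D ≤ d + W then (1 : ℝ) else 0) ≤ W := by
      rw [Finset.sum_boole]
      have : (Finset.range D).filter (fun d => D ≤ d + W) ⊆ Finset.Ico (D - W) D := by
        intro d; simp only [Finset.mem_filter, Finset.mem_range, Finset.mem_Ico]; omega
      have h2 := Finset.card_le_card this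
      rw [Nat.card_Ico] at h2
      exact_mod_cast h2.trans (by omega)
    calc _ ≤ _ := Finset.sum_le_sum hle
      _ = D * (ε / 3 + v q) + ∑ d ∈ Finset.range D, (if D ≤ d + W then (1 : ℝ) else 0) := by
        rw [Finset.sum_add_distrib]; simp; ring
      _ ≤ _ := by nlinarith
  refine ⟨D * ε + D * C, fun n => ?_⟩
  have hn : ((n / D : ℕ) : ℝ) * D ≤ n := by exact_mod_cast Nat.div_mul_le_self n D
  calc _ ≤ _ := sum_range_le_blocks hf0 hD n
    _ ≤ ∑ q ∈ Finset.range (n / D + 1), (2 * (ε / 3) * D + D * v q) :=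
      Finset.sum_le_sum fun q _ => block q
    _ = ((n / D : ℕ) + 1) * (2 * (ε / 3) * D)
        + D * ∑ q ∈ Finset.range (n / D + 1), v q := by
      rw [Finset.sum_add_distrib, Finset.mul_sum]; simp
    _ ≤ ((n / D : ℕ) + 1) * (2 * (ε / 3) * D) + D * (C + ε / 3 * ((n / D : ℕ) + 1)) := by
      have := hC (n / D + 1)
      push_cast at this
      gcongr
    _ = D * ε + D * C + ε * ((n / D : ℕ) * D) := by ring
    _ ≤ _ := by gcongr

/-- The number of entries of the `q`-th row of Pascal's triangle not divisible by `p`. -/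
def nzChoose (p q : ℕ) : ℕ := ((Finset.range (q + 1)).filter fun j => ¬ p ∣ q.choose j).card

theorem one_le_nzChoose {p : ℕ} (hp : p.Prime) (q : ℕ) : 1 ≤ nzChoose p q :=
  Finset.card_pos.2 ⟨0, by simp [hp.one_lt.ne']⟩

theorem not_dvd_choose_mul_add {p : ℕ} (hp : p.Prime) {q d j e : ℕ} (hd : d < p) (he : e ≤ d)
    (hj : ¬ p ∣ q.choose j) : ¬ p ∣ (p * q + d).choose (p * j + e) := by
  have := Fact.mk hp
  have h := Choose.choose_modEq_choose_mod_mul_choose_div_nat (p := p) (n := p * q + d)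
    (k := p * j + e)
  have he' : e < p := he.trans_lt hd
  rw [Nat.mul_add_mod, Nat.mul_add_mod, Nat.mod_eq_of_lt hd, Nat.mod_eq_of_lt he',
    Nat.mul_add_div hp.pos, Nat.mul_add_div hp.pos, Nat.div_eq_of_lt hd, Nat.div_eq_of_lt he',
    add_zero, add_zero] at h
  rw [h.dvd_iff dvd_rfl, hp.dvd_mul, not_or]
  refine ⟨fun hdvd => ?_, hj⟩
  have : p ∣ d.factorial := hdvd.trans (Nat.choose_mul_factorial_mul_factorial he ▸
    Dvd.intro _ (mul_assoc _ _ _).symm)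
  exact absurd ((hp.dvd_factorial).1 this) (by omega)

theorem nzChoose_le {p : ℕ} (hp : p.Prime) {q d : ℕ} (hd : d < p) :
    nzChoose p q ≤ nzChoose p (p * q + d) := by
  refine Finset.card_le_card_of_injOn (fun j => p * j) ?_ ?_
  · intro j
    simp only [Finset.coe_filter, Finset.mem_range, Set.mem_ofPred_eq]
    rintro ⟨h1, h2⟩
    exact ⟨by nlinarith, not_dvd_choose_mul_add hp hd (Nat.zero_le d) h2⟩
  · intro a _ b _ h
    exact Nat.eq_of_mul_eq_mul_left hp.pos h

theorem two_mul_nzChoose_le {p : ℕ} (hp : p.Prime) {q d : ℕ} (hd0 : 0 < d) (hd : d < p) :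
    2 * nzChoose p q ≤ nzChoose p (p * q + d) := by
  rw [mul_comm, ← Finset.card_range 2, nzChoose, ← Finset.card_product]
  refine Finset.card_le_card_of_injOn (fun x => p * x.1 + x.2) ?_ ?_
  · rintro ⟨j, e⟩
    simp only [Finset.coe_product, Finset.coe_filter, Finset.mem_range, Set.mem_prod,
      Set.mem_ofPred_eq, Finset.coe_range, Set.mem_Iio]
    rintro ⟨⟨h1, h2⟩, h3⟩
    exact ⟨by nlinarith, not_dvd_choose_mul_add hp hd (by omega) h2⟩
  · rintro ⟨a, e⟩ h1 ⟨b, e'⟩ h2 h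
    simp only [Finset.coe_product, Finset.coe_filter, Finset.mem_range, Set.mem_prod,
      Set.mem_ofPred_eq, Finset.coe_range, Set.mem_Iio] at h1 h2 h
    have hp2 := hp.two_le
    have h3 := congrArg (· / p) h
    have h4 := congrArg (· % p) h
    simp only [Nat.mul_add_div hp.pos, Nat.mul_add_mod, Nat.mod_eq_of_lt (h1.2.trans_le hp2),
      Nat.mod_eq_of_lt (h2.2.trans_le hp2), Nat.div_eq_of_lt (h1.2.trans_le hp2),
      Nat.div_eq_of_lt (h2.2.trans_le hp2), add_zero] at h3 h4
    rw [h3, h4]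

theorem cesaroNull_inv_nzChoose {p : ℕ} (hp : p.Prime) :
    CesaroNull fun q => ((nzChoose p q : ℝ))⁻¹ := by
  set u : ℕ → ℝ := fun q => ((nzChoose p q : ℝ))⁻¹ with hu
  have hN : ∀ q, (1 : ℝ) ≤ nzChoose p q := fun q => by exact_mod_cast one_le_nzChoose hp q
  have hu0 : ∀ q, 0 ≤ u q := fun q => by positivity
  have hu1 : ∀ q, u q ≤ 1 := fun q => inv_le_one_of_one_le₀ (hN q)
  have hp2 : (2 : ℝ) ≤ p := by exact_mod_cast hp.two_le
  have block : ∀ q, ∑ d ∈ Finset.range p, u (p * q + d) ≤ (3 / 4 * p) * u q := by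
    intro q
    obtain ⟨p', rfl⟩ : ∃ p', p = p' + 1 := ⟨p - 1, by have := hp.pos; omega⟩
    rw [Finset.sum_range_succ']
    have h1 : ∀ d ∈ Finset.range p', u ((p' + 1) * q + (d + 1)) ≤ u q / 2 := by
      intro d hd
      have h := two_mul_nzChoose_le hp (q := q) (Nat.succ_pos d)
        (by have := Finset.mem_range.1 hd; omega)
      have h' : 2 * (nzChoose (p' + 1) q : ℝ) ≤ nzChoose (p' + 1) ((p' + 1) * q + (d + 1)) := by
        exact_mod_cast h
      calc _ ≤ (2 * (nzChoose (p' + 1) q : ℝ))⁻¹ :=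
            inv_anti₀ (by have := hN q; linarith) h'
        _ = _ := by simp only [hu]; rw [mul_inv]; ring
    have h2 : u ((p' + 1) * q + 0) ≤ u q := by
      have h := nzChoose_le hp (q := q) hp.pos
      exact inv_anti₀ (by have := hN q; linarith) (by exact_mod_cast h)
    have h3 := Finset.sum_le_sum h1
    simp only [Finset.sum_const, Finset.card_range, nsmul_eq_mul] at h3
    push_cast at hp2 ⊢
    nlinarith [hu0 q]
  have main : ∀ k : ℕ, ∃ C : ℝ, ∀ n : ℕ,
      ∑ m ∈ Finset.range n, u m ≤ C + (3 / 4 : ℝ) ^ k * n := by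
    intro k
    induction k with
    | zero =>
      refine ⟨0, fun n => ?_⟩
      calc _ ≤ ∑ m ∈ Finset.range n, (1 : ℝ) := Finset.sum_le_sum fun m _ => hu1 m
        _ = _ := by simp
    | succ k ih =>
      obtain ⟨C, hC⟩ := ih
      refine ⟨3 / 4 * p * (C + (3 / 4) ^ k), fun n => ?_⟩
      have hn : ((n / p : ℕ) : ℝ) * p ≤ n := by exact_mod_cast Nat.div_mul_le_self n p
      calc _ ≤ _ := sum_range_le_blocks hu0 hp.pos n
        _ ≤ ∑ q ∈ Finset.range (n / p + 1), (3 / 4 * p) * u q :=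
          Finset.sum_le_sum fun q _ => block q
        _ = (3 / 4 * p) * ∑ q ∈ Finset.range (n / p + 1), u q := by rw [Finset.mul_sum]
        _ ≤ (3 / 4 * p) * (C + (3 / 4 : ℝ) ^ k * ((n / p : ℕ) + 1)) := by
          have := hC (n / p + 1)
          push_cast at this
          gcongr
        _ = 3 / 4 * p * (C + (3 / 4) ^ k) + (3 / 4) ^ (k + 1) * ((n / p : ℕ) * p) := by ring
        _ ≤ _ := by gcongr
  intro ε hε
  obtain ⟨k, hk⟩ := exists_pow_lt_of_lt_one hε (by norm_num : (3 / 4 : ℝ) < 1)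
  obtain ⟨C, hC⟩ := main k
  refine ⟨C, fun n => (hC n).trans ?_⟩
  gcongr

/-- Geometric decay in `nzChoose` is Cesàro-null. -/
theorem cesaroNull_pow_nzChoose {p : ℕ} (hp : p.Prime) {β : ℝ} (hβ : 0 < β) (hβ1 : β ≤ 1) :
    CesaroNull fun q => (1 - β) ^ nzChoose p q := by
  refine ((cesaroNull_inv_nzChoose hp).const_mul (inv_pos.2 hβ)).of_le fun q => ?_
  have hN : (1 : ℝ) ≤ nzChoose p q := by exact_mod_cast one_le_nzChoose hp q
  have h1 : (1 + nzChoose p q * β) ≤ (1 + β) ^ nzChoose p q :=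
    one_add_mul_le_pow (by linarith) _
  have h2 : (1 - β) ^ nzChoose p q * (1 + β) ^ nzChoose p q ≤ 1 := by
    rw [← mul_pow]
    exact pow_le_one₀ (by nlinarith) (by nlinarith)
  rw [← mul_inv, ← one_div, le_div_iff₀ (by positivity)]
  have h3 : 0 ≤ (1 - β) ^ nzChoose p q := pow_nonneg (by linarith) _
  nlinarith

section CosetSum
variable {W V : Type*} [AddCommGroup W] [Fintype W] [AddCommMonoid V]

open Classical in
/-- The sum of `f` over the coset `z + K`. -/
noncomputable def cosetSum (f : W → V) (K : AddSubgroup W) (z : W) : V :=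
  ∑ d ∈ Finset.univ.filter (· ∈ K), f (z + d)

open Classical in
theorem sum_filter_mem_add (f : W → V) (K : AddSubgroup W) {d : W} (hd : d ∈ K) :
    ∑ e ∈ Finset.univ.filter (· ∈ K), f (d + e) = ∑ e ∈ Finset.univ.filter (· ∈ K), f e := by
  refine Finset.sum_equiv (Equiv.addLeft d) (fun e => ?_) (fun e _ => rfl)
  simp [K.add_mem_cancel_left hd]

theorem cosetSum_add_of_mem (f : W → V) (K : AddSubgroup W) (z : W) {d : W} (hd : d ∈ K) :
    cosetSum f K (z + d) = cosetSum f K z := by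
  have := sum_filter_mem_add (fun e => f (z + e)) K hd
  simpa [cosetSum, add_assoc] using this

open Classical in
theorem sum_cosetSum (f : W → V) {K K' : AddSubgroup W} (h : K' ≤ K) (z : W) :
    ∑ d ∈ Finset.univ.filter (· ∈ K), cosetSum f K' (z + d)
      = (Finset.univ.filter (· ∈ K')).card • cosetSum f K z := by
  simp only [cosetSum]
  rw [Finset.sum_comm, ← Finset.sum_const]
  refine Finset.sum_congr rfl fun e he => ?_
  have := sum_filter_mem_add (fun d => f (z + d)) K (h (Finset.mem_filter.1 he).2)
  rw [← this]
  exact Finset.sum_congr rfl fun d _ => by rw [add_comm e d, add_assoc]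

end CosetSum

theorem norm_add_mul_le {p q δ c : ℝ} {ζ : ℂ} (hδ : 0 ≤ δ) (_hδ1 : δ ≤ 1) (hc : 0 ≤ c)
    (hp : 0 ≤ p) (hq : 0 ≤ q) (hpq : δ * p ≤ q) (hqp : δ * q ≤ p) (hζ : ‖ζ‖ = 1)
    (hζc : ‖1 + ζ‖ ≤ 2 - c) : ‖(p : ℂ) + ζ * q‖ ≤ (1 - c * δ / 2) * (p + q) := by
  have h1 : ‖(p : ℂ) + ζ * q‖ ≤ p + q - c * min p q := by
    rcases le_total p q with h | h
    · calc ‖(p : ℂ) + ζ * q‖ = ‖(p : ℂ) * (1 + ζ) + ζ * ((q - p : ℝ) : ℂ)‖ := by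
            push_cast; ring_nf
        _ ≤ ‖(p : ℂ) * (1 + ζ)‖ + ‖ζ * ((q - p : ℝ) : ℂ)‖ := norm_add_le _ _
        _ = p * ‖1 + ζ‖ + (q - p) := by
          rw [norm_mul, norm_mul, hζ, Complex.norm_of_nonneg hp,
            Complex.norm_of_nonneg (sub_nonneg.2 h), one_mul]
        _ ≤ p * (2 - c) + (q - p) := by gcongr
        _ = _ := by rw [min_eq_left h]; ring
    · calc ‖(p : ℂ) + ζ * q‖ = ‖(q : ℂ) * (1 + ζ) + ((p - q : ℝ) : ℂ)‖ := by
            push_cast; ring_nf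
        _ ≤ ‖(q : ℂ) * (1 + ζ)‖ + ‖((p - q : ℝ) : ℂ)‖ := norm_add_le _ _
        _ = q * ‖1 + ζ‖ + (p - q) := by
          rw [norm_mul, Complex.norm_of_nonneg hq, Complex.norm_of_nonneg (sub_nonneg.2 h)]
        _ ≤ q * (2 - c) + (p - q) := by gcongr
        _ = _ := by rw [min_eq_right h]; ring
  have h2 : δ * (p + q) / 2 ≤ min p q := by
    refine le_min ?_ ?_ <;> nlinarith
  nlinarith

section Contraction
variable {W : Type*} [AddCommGroup W] [Fintype W] {w : W → ℝ} {ψ : W → ℂ}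

theorem norm_cosetSum_le (hw : ∀ z, 0 ≤ w z) (hψ : ∀ z, ‖ψ z‖ ≤ 1) (K : AddSubgroup W) (z : W) :
    ‖cosetSum (fun z => (w z : ℂ) * ψ z) K z‖ ≤ cosetSum w K z := by
  refine norm_sum_le_of_le _ fun d _ => ?_
  rw [norm_mul, Complex.norm_of_nonneg (hw _)]
  exact mul_le_of_le_one_right (hw _) (hψ _)

theorem cosetSum_nonneg (hw : ∀ z, 0 ≤ w z) (K : AddSubgroup W) (z : W) : 0 ≤ cosetSum w K z :=
  Finset.sum_nonneg fun _ _ => hw _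

/-- A bound on the twisted sums over the cosets of `K'` passes to any larger subgroup. -/
theorem norm_cosetSum_mono {K K' : AddSubgroup W} (hK : K' ≤ K) {κ : ℝ}
    (hκ : ∀ z, ‖cosetSum (fun z => (w z : ℂ) * ψ z) K' z‖ ≤ κ * cosetSum w K' z) (z : W) :
    ‖cosetSum (fun z => (w z : ℂ) * ψ z) K z‖ ≤ κ * cosetSum w K z := by
  classical
  have h1 := sum_cosetSum (fun z => (w z : ℂ) * ψ z) hK z
  have h2 := sum_cosetSum w hK z
  set N := (Finset.univ.filter (· ∈ K')).card
  have hN : (0 : ℝ) < N := by exact_mod_cast Finset.card_pos.2 ⟨0, by simp [K'.zero_mem]⟩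
  have h3 : ‖∑ d ∈ Finset.univ.filter (· ∈ K),
      cosetSum (fun z => (w z : ℂ) * ψ z) K' (z + d)‖
      ≤ ∑ d ∈ Finset.univ.filter (· ∈ K), κ * cosetSum w K' (z + d) :=
    norm_sum_le_of_le _ fun d _ => hκ _
  rw [← Finset.mul_sum, h1, h2, nsmul_eq_mul, nsmul_eq_mul, norm_mul, Complex.norm_natCast] at h3
  exact le_of_mul_le_mul_left (by linarith) hN

/-- One contraction step: a translation `h` multiplying `ψ` by `ζ ≠ 1`, under which the weights
are quasi-invariant (constant `δ`) and almost invariant given the `K'`-coset (constant `C`). -/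
theorem norm_cosetSum_step (hw : ∀ z, 0 ≤ w z) (hψ : ∀ z, ‖ψ z‖ ≤ 1)
    {K K' : AddSubgroup W} (hK : K' ≤ K) {h : W} (hh : h ∈ K) {ζ : ℂ} (hζ : ‖ζ‖ = 1)
    {δ c C κ : ℝ} (hδ : 0 < δ) (hδ1 : δ ≤ 1) (hc : 0 ≤ c) (hζc : ‖1 + ζ‖ ≤ 2 - c)
    (hψh : ∀ z, ψ (z + h) = ζ * ψ z) (hκ0 : 0 ≤ κ)
    (hfe : ∀ z, δ * cosetSum w K' z ≤ cosetSum w K' (z + h))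
    (hfe' : ∀ z, δ * cosetSum w K' (z + h) ≤ cosetSum w K' z)
    (hd : ∀ z, w (z + h) * cosetSum w K' z ≤ C * (w z * cosetSum w K' (z + h)))
    (hd' : ∀ z, w z * cosetSum w K' (z + h) ≤ C * (w (z + h) * cosetSum w K' z))
    (hκ : ∀ z, ‖cosetSum (fun z => (w z : ℂ) * ψ z) K' z‖ ≤ κ * cosetSum w K' z) (z : W) :
    ‖cosetSum (fun z => (w z : ℂ) * ψ z) K z‖
      ≤ ((1 - c * δ / 2) * κ + (C - 1)) * cosetSum w K z := by
  classical
  set I := cosetSum (fun z => (w z : ℂ) * ψ z) with hI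
  set P := cosetSum w with hP
  have hP0 : ∀ K z, 0 ≤ P K z := cosetSum_nonneg hw
  have tv : ∀ z, ‖(P K' z : ℂ) * I K' (z + h) - ζ * P K' (z + h) * I K' z‖
      ≤ (C - 1) * (2 * (P K' z * P K' (z + h))) := by
    intro z
    have e1 : (P K' z : ℂ) * I K' (z + h) - ζ * P K' (z + h) * I K' z
        = ∑ d ∈ Finset.univ.filter (· ∈ K'), (ζ * ψ (z + d)) *
          ((w (z + d + h) * P K' z - w (z + d) * P K' (z + h) : ℝ) : ℂ) := by
      simp only [hI, cosetSum, Finset.mul_sum]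
      rw [← Finset.sum_sub_distrib]
      refine Finset.sum_congr rfl fun d _ => ?_
      rw [add_right_comm z h d, hψh]
      push_cast
      ring
    have e2 : ∀ d ∈ Finset.univ.filter (· ∈ K'), ‖(ζ * ψ (z + d)) *
          ((w (z + d + h) * P K' z - w (z + d) * P K' (z + h) : ℝ) : ℂ)‖
        ≤ (C - 1) * (w (z + h + d) * P K' z + w (z + d) * P K' (z + h)) := by
      intro d hdK
      have hdK := (Finset.mem_filter.1 hdK).2
      have a1 := hd (z + d)
      have a2 := hd' (z + d)
      rw [add_right_comm z d h, hP, cosetSum_add_of_mem w K' z hdK,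
        cosetSum_add_of_mem w K' (z + h) hdK, ← hP] at a1 a2
      rw [norm_mul, norm_mul, hζ, one_mul, Complex.norm_real, Real.norm_eq_abs,
        add_right_comm z d h]
      refine (mul_le_of_le_one_left (abs_nonneg _) (hψ _)).trans ?_
      have b1 := mul_nonneg (hw (z + h + d)) (hP0 K' z)
      have b2 := mul_nonneg (hw (z + d)) (hP0 K' (z + h))
      rw [abs_le]
      constructor <;> nlinarith
    rw [e1]
    refine (norm_sum_le_of_le _ e2).trans (le_of_eq ?_)
    rw [← Finset.mul_sum, Finset.sum_add_distrib, ← Finset.sum_mul, ← Finset.sum_mul]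
    simp only [hP, cosetSum]
    ring
  have pair : ∀ z, ‖I K' z + I K' (z + h)‖
      ≤ (1 - c * δ / 2) * κ * (P K' z + P K' (z + h)) + 2 * (C - 1) * P K' (z + h) := by
    intro z
    rcases (hP0 K' z).eq_or_lt with h0 | h0
    · have h1 : P K' (z + h) = 0 := by
        have := hfe' z; have := hP0 K' (z + h); nlinarith
      have n1 := norm_cosetSum_le hw hψ K' z
      have n2 := norm_cosetSum_le hw hψ K' (z + h)
      rw [← hP, ← hI] at n1 n2
      rw [h1] at n2 ⊢
      rw [← h0] at n1 ⊢
      have := norm_add_le (I K' z) (I K' (z + h))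
      linarith
    · have m1 := norm_add_mul_le hδ.le hδ1 hc h0.le (hP0 K' (z + h)) (hfe z) (hfe' z) hζ hζc
      have m2 : (P K' z : ℂ) * (I K' z + I K' (z + h))
          = I K' z * (P K' z + ζ * P K' (z + h))
            + (P K' z * I K' (z + h) - ζ * P K' (z + h) * I K' z) := by ring
      have m3 : P K' z * ‖I K' z + I K' (z + h)‖
          ≤ κ * P K' z * ((1 - c * δ / 2) * (P K' z + P K' (z + h)))
            + (C - 1) * (2 * (P K' z * P K' (z + h))) := by
        rw [← Complex.norm_of_nonneg h0.le, ← norm_mul, m2]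
        refine (norm_add_le _ _).trans (add_le_add ?_ ?_)
        · rw [norm_mul, Complex.norm_of_nonneg h0.le]
          exact mul_le_mul (hκ z) m1 (norm_nonneg _) (mul_nonneg hκ0 h0.le)
        · rw [Complex.norm_of_nonneg h0.le]; exact tv z
      refine le_of_mul_le_mul_left (m3.trans (le_of_eq ?_)) h0
      ring
  have h1 := sum_cosetSum (fun z => (w z : ℂ) * ψ z) hK z
  have h1' := sum_cosetSum (fun z => (w z : ℂ) * ψ z) hK (z + h)
  have h2 := sum_cosetSum w hK z
  have h2' := sum_cosetSum w hK (z + h)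
  rw [cosetSum_add_of_mem _ K z hh] at h1' h2'
  rw [← hI] at h1 h1'
  rw [← hP] at h2 h2'
  set N := (Finset.univ.filter (· ∈ K')).card
  have hN : (0 : ℝ) < N := by exact_mod_cast Finset.card_pos.2 ⟨0, by simp [K'.zero_mem]⟩
  have h3 : ‖∑ d ∈ Finset.univ.filter (· ∈ K), (I K' (z + d) + I K' (z + d + h))‖
      ≤ ∑ d ∈ Finset.univ.filter (· ∈ K), ((1 - c * δ / 2) * κ *
        (P K' (z + d) + P K' (z + d + h)) + 2 * (C - 1) * P K' (z + d + h)) :=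
    norm_sum_le_of_le _ fun d _ => pair _
  simp only [add_right_comm z _ h] at h3
  rw [Finset.sum_add_distrib, Finset.sum_add_distrib, ← Finset.mul_sum, ← Finset.mul_sum,
    Finset.sum_add_distrib, h1, h1', h2, h2', ← two_mul, nsmul_eq_mul, nsmul_eq_mul, norm_mul,
    norm_mul, Complex.norm_natCast, Complex.norm_ofNat] at h3
  refine le_of_mul_le_mul_left ?_ (mul_pos two_pos hN)
  linarith

/-- Iterated contraction along a decreasing chain of subgroups. -/
theorem norm_cosetSum_chain (hw : ∀ z, 0 ≤ w z) (hψ : ∀ z, ‖ψ z‖ ≤ 1)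
    {K : ℕ → AddSubgroup W} (hK : Antitone K) {δ c C : ℝ} (hδ : 0 < δ) (hδ1 : δ ≤ 1)
    (hc : 0 < c) (hc1 : c ≤ 2) (hC : 1 ≤ C) (Q : ℕ) (S : Finset ℕ)
    (hS : ∀ j ∈ S, j < Q → ∃ h ∈ K j, ∃ ζ : ℂ, ‖ζ‖ = 1 ∧ ‖1 + ζ‖ ≤ 2 - c ∧
      (∀ z, ψ (z + h) = ζ * ψ z) ∧
      (∀ z, δ * cosetSum w (K (j + 1)) z ≤ cosetSum w (K (j + 1)) (z + h)) ∧
      (∀ z, δ * cosetSum w (K (j + 1)) (z + h) ≤ cosetSum w (K (j + 1)) z) ∧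
      (∀ z, w (z + h) * cosetSum w (K (j + 1)) z
        ≤ C * (w z * cosetSum w (K (j + 1)) (z + h))) ∧
      (∀ z, w z * cosetSum w (K (j + 1)) (z + h)
        ≤ C * (w (z + h) * cosetSum w (K (j + 1)) z))) :
    ‖∑ z, (w z : ℂ) * ψ z‖
      ≤ ((1 - c * δ / 2) ^ (S.filter (· < Q)).card + (C - 1) / (c * δ / 2)) * ∑ z, w z := by
  classical
  set β := c * δ / 2 with hβ
  have hβ0 : 0 < β := by positivity
  have hβ1 : β ≤ 1 := by nlinarith
  have hE : 0 ≤ (C - 1) / β := div_nonneg (by linarith) hβ0.le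
  have main : ∀ i ≤ Q, ∀ z, ‖cosetSum (fun z => (w z : ℂ) * ψ z) (K (Q - i)) z‖
      ≤ ((1 - β) ^ (S.filter fun j => Q - i ≤ j ∧ j < Q).card + (C - 1) / β)
        * cosetSum w (K (Q - i)) z := by
    intro i
    induction i with
    | zero =>
      intro _ z
      have : S.filter (fun j => Q - 0 ≤ j ∧ j < Q) = ∅ :=
        Finset.filter_eq_empty_iff.2 fun j _ => by omega
      rw [this, Finset.card_empty, pow_zero]
      exact (norm_cosetSum_le hw hψ _ z).trans
        (le_mul_of_one_le_left (cosetSum_nonneg hw _ z) (by linarith))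
    | succ i ih =>
      intro hi z
      have ih := ih (by omega)
      obtain ⟨j, hj, hjQ⟩ : ∃ j, Q - i = j + 1 ∧ Q - (i + 1) = j := ⟨Q - (i + 1), by omega, rfl⟩
      have hjQ' : j < Q := by omega
      rw [hj] at ih
      rw [hjQ]
      set κ := (1 - β) ^ (S.filter fun k => j + 1 ≤ k ∧ k < Q).card + (C - 1) / β with hκ
      have hκ0 : 0 ≤ κ := add_nonneg (pow_nonneg (by linarith) _) hE
      by_cases hjS : j ∈ S
      · obtain ⟨h, hh, ζ, hζ, hζc, hψh, f1, f2, d1, d2⟩ := hS j hjS hjQ'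
        have := norm_cosetSum_step hw hψ (hK (Nat.le_succ j)) hh hζ hδ hδ1 hc.le hζc hψh hκ0
          f1 f2 d1 d2 ih z
        refine this.trans (le_of_eq ?_)
        have hins : S.filter (fun k => j ≤ k ∧ k < Q)
            = insert j (S.filter fun k => j + 1 ≤ k ∧ k < Q) := by
          ext k
          simp only [Finset.mem_filter, Finset.mem_insert]
          constructor
          · rintro ⟨h1, h2, h3⟩
            rcases h2.eq_or_lt with h | h
            · exact Or.inl h.symm
            · exact Or.inr ⟨h1, h, h3⟩
          · rintro (rfl | ⟨h1, h2, h3⟩)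
            · exact ⟨hjS, le_rfl, hjQ'⟩
            · exact ⟨h1, by omega, h3⟩
        rw [hins, Finset.card_insert_of_notMem (by simp), pow_succ, hκ, ← hβ]
        congr 1
        field_simp
        ring
      · have := norm_cosetSum_mono (hK (Nat.le_succ j)) ih z
        have heq : S.filter (fun k => j ≤ k ∧ k < Q)
            = S.filter fun k => j + 1 ≤ k ∧ k < Q := by
          refine Finset.filter_congr fun k hk => ?_
          have : k ≠ j := fun h => hjS (h ▸ hk)
          omega
        rwa [heq]
  have h0 := norm_cosetSum_mono (le_top : K (Q - Q) ≤ ⊤) (main Q le_rfl) 0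
  simpa [cosetSum] using h0

end Contraction

section Window
variable {G : Type*}

/-- The shift by `k`. -/
def shiftBy (k : ℤ) (x : ℤ → G) : ℤ → G := fun n => x (n + k)

/-- The points agreeing with `x` on `[a, b)`. -/
def win (x : ℤ → G) (a b : ℤ) : Set (ℤ → G) := {y | ∀ i, a ≤ i → i < b → y i = x i}

theorem win_congr {x y : ℤ → G} {a b : ℤ} (h : ∀ i, a ≤ i → i < b → x i = y i) :
    win x a b = win y a b := by
  ext z
  exact forall_congr' fun i => forall_congr' fun h1 => forall_congr' fun h2 => by rw [h i h1 h2]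

theorem win_subset (x : ℤ → G) {a b b' : ℤ} (h : b ≤ b') : win x a b' ⊆ win x a b :=
  fun _ hy i h1 h2 => hy i h1 (h2.trans_le h)

theorem preimage_shiftBy_win (x : ℤ → G) (a b k : ℤ) :
    shiftBy k ⁻¹' win (shiftBy k x) a b = win x (a + k) (b + k) := by
  ext y
  constructor
  · intro h i h1 h2
    have := h (i - k) (by linarith) (by linarith)
    simpa [shiftBy] using this
  · intro h i h1 h2
    exact h (i + k) (by linarith) (by linarith)

theorem shiftBy_mem_TMC {E : Set (G × G)} {x : ℤ → G} (hx : x ∈ TMC E) (k : ℤ) :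
    shiftBy k x ∈ TMC E := fun i => by
  have := hx (i + k)
  rwa [show i + k + 1 = i + 1 + k by ring] at this

theorem win_eq_cyl (x : ℤ → G) (m : ℕ) :
    win x 0 m = cyl fun i : Fin m => x ((i : ℕ) : ℤ) := by
  ext y
  constructor
  · intro h i
    exact h _ (by positivity) (by exact_mod_cast i.2)
  · intro h i h0 h1
    lift i to ℕ using h0
    exact h ⟨i, by exact_mod_cast h1⟩

variable [MeasurableSpace G]

theorem measurable_shiftBy (k : ℤ) : Measurable (shiftBy k : (ℤ → G) → ℤ → G) :=
  measurable_pi_lambda _ fun n => measurable_pi_apply (n + k)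

variable {E : Set (G × G)} {μ : Measure (ℤ → G)}

theorem map_shiftBy (h : Measure.map shiftMap μ = μ) (k : ℤ) :
    Measure.map (shiftBy k) μ = μ := by
  have hnat : ∀ k : ℕ, Measure.map (shiftBy (k : ℤ)) μ = μ := by
    intro k
    induction k with
    | zero =>
      have : (shiftBy ((0 : ℕ) : ℤ) : (ℤ → G) → ℤ → G) = id := by
        funext x n; simp [shiftBy]
      rw [this, Measure.map_id]
    | succ k ih =>
      have : (shiftBy ((k + 1 : ℕ) : ℤ) : (ℤ → G) → ℤ → G) = shiftBy (k : ℤ) ∘ shiftBy 1 := by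
        funext x n; simp [shiftBy, add_assoc]
      rw [this, ← Measure.map_map (measurable_shiftBy _) (measurable_shiftBy _)]
      have h1 : Measure.map (shiftBy 1) μ = μ := h
      rw [h1, ih]
  obtain ⟨m, rfl | rfl⟩ := k.eq_nat_or_neg
  · exact hnat m
  · conv_lhs => rw [← hnat m, Measure.map_map (measurable_shiftBy _) (measurable_shiftBy _)]
    have : (shiftBy (-(m : ℤ)) : (ℤ → G) → ℤ → G) ∘ shiftBy (m : ℤ) = id := by
      funext x n; simp [shiftBy]
    rw [this, Measure.map_id]

variable [MeasurableSingletonClass G]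

theorem measurableSet_win (x : ℤ → G) (a b : ℤ) : MeasurableSet (win x a b) := by
  have : win x a b = ⋂ i : ℤ, ⋂ _ : a ≤ i, ⋂ _ : i < b, (fun y : ℤ → G => y i) ⁻¹' {x i} := by
    ext y; simp [win]
  rw [this]
  exact MeasurableSet.iInter fun i => MeasurableSet.iInter fun _ => MeasurableSet.iInter fun _ =>
    measurable_pi_apply i (measurableSet_singleton _)

theorem real_win_shiftBy (h : Measure.map shiftMap μ = μ) (x : ℤ → G) (a b k : ℤ) :
    μ.real (win (shiftBy k x) a b) = μ.real (win x (a + k) (b + k)) := by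
  conv_lhs => rw [← map_shiftBy h k]
  rw [map_measureReal_apply (measurable_shiftBy k) (measurableSet_win _ _ _),
    preimage_shiftBy_win]

theorem real_win_pos (hg : GoodMeasure E μ) {x : ℤ → G} (hx : x ∈ TMC E) (a b : ℤ) :
    0 < μ.real (win x a b) := by
  have := hg.1
  have h := real_win_shiftBy hg.2.1 x 0 ((b - a).toNat) a
  have hsub : win x (0 + a) ((b - a).toNat + a) ⊆ win x a b := by
    intro y hy i h1 h2
    exact hy i (by omega) (by omega)
  refine lt_of_lt_of_le ?_ (measureReal_mono hsub)
  rw [← h, win_eq_cyl, measureReal_def]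
  exact ENNReal.toReal_pos (hg.2.2.2 _ _ ⟨_, shiftBy_mem_TMC hx a, 0, fun i => by simp⟩).ne'
    (measure_ne_top _ _)

theorem ae_mem_TMC [Finite G] (hg : GoodMeasure E μ) : ∀ᵐ x ∂μ, x ∈ TMC E := by
  have := hg.1
  have hm : MeasurableSet (TMC E) := by
    have : TMC E = ⋂ i : ℤ, (fun y : ℤ → G => (y i, y (i + 1))) ⁻¹' E := by
      ext y; simp [TMC]
    rw [this]
    exact MeasurableSet.iInter fun i =>
      ((measurable_pi_apply i).prodMk (measurable_pi_apply (i + 1))) (Set.toFinite E).measurableSet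
  exact (mem_ae_iff_prob_eq_one hm).2 hg.2.2.1

theorem exists_mem_TMC_of_pos [Finite G] (hg : GoodMeasure E μ) {s : Set (ℤ → G)}
    (hs : μ.real s ≠ 0) : ∃ x ∈ s, x ∈ TMC E := by
  by_contra! hcon
  apply hs
  rw [measureReal_def, measure_eq_zero_iff_ae_notMem.2, ENNReal.toReal_zero]
  filter_upwards [ae_mem_TMC hg] with x hx hxs using hcon x hxs hx

/-- Disintegration of a measure of a set along a finite-valued map. -/
theorem setIntegral_fiber_ratio {Ω S : Type*} [MeasurableSpace Ω] [Finite S] [MeasurableSpace S]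
    [MeasurableSingletonClass S] {μ : Measure Ω} [IsFiniteMeasure μ] {π : Ω → S}
    (hπ : Measurable π) (T : Set S) (B : Set Ω) :
    ∫ y in π ⁻¹' T, μ.real (π ⁻¹' {π y} ∩ B) / μ.real (π ⁻¹' {π y}) ∂μ
      = μ.real (π ⁻¹' T ∩ B) := by
  classical
  have := Fintype.ofFinite S
  have hT : MeasurableSet T := T.toFinite.measurableSet
  have hsum : ∀ ρ : Measure Ω, IsFiniteMeasure ρ →
      ρ.real (π ⁻¹' T) = ∑ s, T.indicator (fun s => ρ.real (π ⁻¹' {s})) s := by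
    intro ρ _
    have h := integral_fintype (μ := ρ.map π) (f := T.indicator (fun _ => (1 : ℝ)))
      Integrable.of_finite
    rw [integral_indicator hT, setIntegral_const, map_measureReal_apply hπ hT] at h
    simp only [smul_eq_mul, mul_one] at h
    rw [h]
    refine Finset.sum_congr rfl fun s _ => ?_
    rw [map_measureReal_apply hπ (measurableSet_singleton s)]
    by_cases hs : s ∈ T <;> simp [hs]
  have h1 := hsum (μ.restrict B) inferInstance
  rw [measureReal_restrict_apply (hπ hT)] at h1
  rw [h1, ← setIntegral_map (f := fun s => μ.real (π ⁻¹' {s} ∩ B) / μ.real (π ⁻¹' {s})) hT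
    Integrable.of_finite.aestronglyMeasurable hπ.aemeasurable, ← integral_indicator hT,
    integral_fintype Integrable.of_finite]
  refine Finset.sum_congr rfl fun s _ => ?_
  rw [map_measureReal_apply hπ (measurableSet_singleton s)]
  by_cases hs : s ∈ T
  · simp only [Set.indicator_of_mem hs, smul_eq_mul]
    rw [measureReal_restrict_apply (hπ (measurableSet_singleton s))]
    by_cases h0 : μ.real (π ⁻¹' {s}) = 0
    · rw [h0, zero_mul]
      exact (le_antisymm ((measureReal_mono Set.inter_subset_left).trans h0.le)
        measureReal_nonneg).symm
    · field_simp
  · simp [hs]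

end Window

section Distortion
variable {G : Type*} {E : Set (G × G)}

/-- The past of `y`, read backwards from coordinate `-1`. -/
def pastOf (y : ℤ → G) : ℕ → G := fun i => y (-1 - i)

theorem isPast_pastOf {y : ℤ → G} (hy : y ∈ TMC E) : IsPast E (pastOf y) := fun i => by
  have := hy (-1 - (i + 1 : ℕ))
  rwa [show (-1 - ((i + 1 : ℕ) : ℤ) + 1) = -1 - (i : ℤ) by push_cast; ring] at this

theorem cyl_pastWord (y : ℤ → G) (M : ℕ) :
    cyl (pastWord (pastOf y) M) = win (shiftBy (-M) y) 0 M := by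
  rw [win_eq_cyl]
  congr 1
  funext j
  simp only [pastWord, pastOf, shiftBy]
  congr 1
  have := j.2
  omega

theorem cyl_snoc_pastWord (y : ℤ → G) (M : ℕ) (a : G) :
    cyl (Fin.snoc (pastWord (pastOf y) M) a : Fin (M + 1) → G)
      = win (shiftBy (-M) (Function.update y 0 a)) 0 (M + 1 : ℕ) := by
  rw [win_eq_cyl]
  congr 1
  funext j
  refine Fin.lastCases ?_ (fun i => ?_) j
  · simp [shiftBy]
  · have := i.2
    simp only [Fin.snoc_castSucc, pastWord, pastOf, shiftBy, Fin.val_castSucc]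
    rw [Function.update_of_ne (by omega)]
    congr 1
    omega

theorem win_inter_letter (x : ℤ → G) {b : ℤ} (hb : b ≤ 0) (a : G) :
    win x b 0 ∩ {z | z 0 = a} = win (Function.update x 0 a) b 1 := by
  ext z
  constructor
  · rintro ⟨h1, h2⟩ i hi hi'
    rcases eq_or_lt_of_le (Int.lt_add_one_iff.1 hi' : i ≤ 0) with rfl | h
    · simpa using h2
    · rw [Function.update_of_ne h.ne]; exact h1 i hi h
  · intro h
    refine ⟨fun i hi hi' => ?_, ?_⟩
    · have := h i hi (by omega)
      rwa [Function.update_of_ne hi'.ne] at this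
    · simpa using h 0 hb (by norm_num)

variable [MeasurableSpace G] {μ : Measure (ℤ → G)}

/-- The conditional probability of the letter `a` at `0` given the last `M` coordinates of `y`. -/
noncomputable def condLetter (μ : Measure (ℤ → G)) (a : G) (M : ℕ) (y : ℤ → G) : ℝ :=
  μ.real (win y (-M) 0 ∩ {z | z 0 = a}) / μ.real (win y (-M) 0)

theorem condLetter_nonneg (a : G) (M : ℕ) (y : ℤ → G) : 0 ≤ condLetter μ a M y :=
  div_nonneg measureReal_nonneg measureReal_nonneg

theorem condLetter_le_one [IsFiniteMeasure μ] (a : G) (M : ℕ) (y : ℤ → G) :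
    condLetter μ a M y ≤ 1 :=
  div_le_one_of_le₀ (measureReal_mono Set.inter_subset_left) measureReal_nonneg

theorem exists_pos_le_real_cyl [Finite G] (μ : Measure (ℤ → G)) (L : ℕ) :
    ∃ δ : ℝ, 0 < δ ∧ δ ≤ 1 ∧ ∀ w : Fin L → G, μ.real (cyl w) ≠ 0 → δ ≤ μ.real (cyl w) := by
  classical
  let f : Option (Fin L → G) → ℝ := fun o =>
    o.elim 1 fun w => if μ.real (cyl w) = 0 then 1 else μ.real (cyl w)
  obtain ⟨o, ho⟩ := Finite.exists_min f
  refine ⟨f o, ?_, ho none, fun w hw => by simpa [f, hw] using ho (some w)⟩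
  rcases o with _ | w
  · exact one_pos
  · by_cases hw : μ.real (cyl w) = 0
    · simp [f, hw]
    · simpa [f, hw] using lt_of_le_of_ne measureReal_nonneg (Ne.symm hw)

variable [MeasurableSingletonClass G]

theorem tendsto_condLetter (hμ : Measure.map shiftMap μ = μ) {ν : (ℕ → G) → G → ℝ} {y : ℤ → G}
    {a : G}
    (h : Tendsto (fun m : ℕ =>
          (μ (cyl (Fin.snoc (pastWord (pastOf y) m) a : Fin (m + 1) → G))).toReal /
            (μ (cyl (pastWord (pastOf y) m))).toReal) atTop (nhds (ν (pastOf y) a))) :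
    Tendsto (fun M => condLetter μ a M y) atTop (𝓝 (ν (pastOf y) a)) := by
  refine h.congr fun M => ?_
  rw [cyl_pastWord, cyl_snoc_pastWord, ← measureReal_def, ← measureReal_def,
    real_win_shiftBy hμ, real_win_shiftBy hμ, condLetter, win_inter_letter y (by omega)]
  congr 4 <;> push_cast <;> ring

theorem setIntegral_condLetter [Finite G] [IsFiniteMeasure μ] (a : G) (x : ℤ → G) {b : ℤ} (M : ℕ)
    (hM : -(M : ℤ) ≤ b) :
    ∫ y in win x b 0, condLetter μ a M y ∂μ = μ.real (win x b 0 ∩ {z | z 0 = a}) := by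
  let π : (ℤ → G) → Fin M → G := fun y i => y ((i : ℕ) - M)
  have hπ : Measurable π := measurable_pi_lambda _ fun i => measurable_pi_apply _
  have hfib : ∀ y, π ⁻¹' {π y} = win y (-M) 0 := by
    intro y
    ext z
    constructor
    · intro h i h1 h2
      have := congrFun (h : π z = π y) ⟨(i + M).toNat, by omega⟩
      simp only [π] at this
      rwa [show (((i + M).toNat : ℕ) : ℤ) - M = i by omega] at this
    · intro h
      funext i
      have := i.2
      exact h _ (by omega) (by omega)
  have hT : π ⁻¹' (π '' win x b 0) = win x b 0 := by
    refine Set.Subset.antisymm ?_ (Set.subset_preimage_image _ _)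
    rintro z ⟨w, hw, hwz⟩ i h1 h2
    have : w ∈ π ⁻¹' {π z} := hwz
    rw [hfib] at this
    rw [← this i (by omega) h2]
    exact hw i h1 h2
  have := setIntegral_fiber_ratio (μ := μ) hπ (π '' win x b 0) {z | z 0 = a}
  rw [hT] at this
  rw [← this]
  simp only [hfib]
  rfl

theorem measurable_condLetter [Finite G] (a : G) (M : ℕ) : Measurable (condLetter μ a M) := by
  let π : (ℤ → G) → Fin M → G := fun y i => y ((i : ℕ) - M)
  have hπ : Measurable π := measurable_pi_lambda _ fun i => measurable_pi_apply _
  have hfac : Function.FactorsThrough (condLetter μ a M) π := by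
    intro y z h
    have : win y (-M) 0 = win z (-M) 0 := win_congr fun i h1 h2 => by
      have := congrFun h ⟨(i + M).toNat, by omega⟩
      simp only [π] at this
      rwa [show (((i + M).toNat : ℕ) : ℤ) - M = i by omega] at this
    simp only [condLetter, this]
  have : condLetter μ a M = Function.extend π (condLetter μ a M) 0 ∘ π := by
    funext y
    exact (hfac.extend_apply 0 y).symm
  rw [this]
  exact (measurable_of_finite _).comp hπ

theorem integral_transition [Finite G] (hg : GoodMeasure E μ) {ν : (ℕ → G) → G → ℝ}
    (hν : ∀ p, IsPast E p → ∀ a, (p 0, a) ∈ E →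
      0 < ν p a ∧
      Tendsto (fun m : ℕ =>
          (μ (cyl (Fin.snoc (pastWord p m) a : Fin (m + 1) → G))).toReal /
            (μ (cyl (pastWord p m))).toReal)
        atTop (nhds (ν p a))) {x : ℤ → G} (hx : x ∈ TMC E) {b : ℤ} (hb : b ≤ -1) :
    IntegrableOn (fun y => ν (pastOf y) (x 0)) (win x b 0) μ ∧
    ∫ y in win x b 0, ν (pastOf y) (x 0) ∂μ = μ.real (win x b 1) := by
  have := hg.1
  have hlim : ∀ᵐ y ∂μ.restrict (win x b 0),
      Tendsto (fun M => condLetter μ (x 0) M y) atTop (𝓝 (ν (pastOf y) (x 0))) := by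
    rw [ae_restrict_iff' (measurableSet_win _ _ _)]
    filter_upwards [ae_mem_TMC hg] with y hy hyw
    refine tendsto_condLetter hg.2.1 (hν _ (isPast_pastOf hy) _ ?_).2
    have h1 := hyw (-1) hb (by norm_num)
    have h2 := hx (-1)
    simp only [pastOf, Nat.cast_zero, sub_zero, h1]
    simpa using h2
  have hmeas : AEStronglyMeasurable (fun y => ν (pastOf y) (x 0)) (μ.restrict (win x b 0)) :=
    aestronglyMeasurable_of_tendsto_ae atTop
      (fun M => (measurable_condLetter (x 0) M).aestronglyMeasurable) hlim
  have hbd : ∀ M y, ‖condLetter μ (x 0) M y‖ ≤ 1 := fun M y => by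
    rw [Real.norm_of_nonneg (condLetter_nonneg _ _ _)]
    exact condLetter_le_one _ _ _
  refine ⟨Integrable.of_bound hmeas 1 ?_, ?_⟩
  · filter_upwards [hlim] with y hy
    exact le_of_tendsto hy.norm (Eventually.of_forall fun M => hbd M y)
  · have h1 := tendsto_integral_of_dominated_convergence (μ := μ.restrict (win x b 0))
      (F := fun M y => condLetter μ (x 0) M y) (fun _ => (1 : ℝ))
      (fun M => (measurable_condLetter (x 0) M).aestronglyMeasurable) (integrable_const _)
      (fun M => Eventually.of_forall (hbd M)) hlim
    refine tendsto_nhds_unique h1 (tendsto_const_nhds.congr' ?_)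
    filter_upwards [eventually_ge_atTop (-b).toNat] with M hM
    rw [setIntegral_condLetter _ _ _ (by omega), win_inter_letter _ (by omega),
      Function.update_eq_self]

theorem win_ratio_step_zero [Finite G] (hg : GoodMeasure E μ) {ν : (ℕ → G) → G → ℝ}
    (hν : ∀ p, IsPast E p → ∀ a, (p 0, a) ∈ E →
      0 < ν p a ∧
      Tendsto (fun m : ℕ =>
          (μ (cyl (Fin.snoc (pastWord p m) a : Fin (m + 1) → G))).toReal /
            (μ (cyl (pastWord p m))).toReal)
        atTop (nhds (ν p a))) {γ : ℕ → ℝ}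
    (hγ : ∀ m : ℕ, 1 ≤ m → ∀ p q, IsPast E p → IsPast E q → (∀ i < m, p i = q i) →
        ∀ a, (p 0, a) ∈ E → |ν p a / ν q a - 1| ≤ γ m)
    {m : ℕ} (hm : 1 ≤ m) {x x' : ℤ → G} (hx : x ∈ TMC E) (hx' : x' ∈ TMC E) {a a' : ℤ}
    (ha : a ≤ -m) (ha' : a' ≤ -m) (hag : ∀ i, -(m : ℤ) ≤ i → i < 1 → x i = x' i) :
    μ.real (win x a 1) * μ.real (win x' a' 0)
      ≤ (1 + γ m) * (μ.real (win x' a' 1) * μ.real (win x a 0)) := by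
  have := hg.1
  obtain ⟨hi, he⟩ := integral_transition hg hν hx (b := a) (by omega)
  obtain ⟨hi', he'⟩ := integral_transition hg hν hx' (b := a') (by omega)
  have h0 : x 0 = x' 0 := hag 0 (by omega) (by norm_num)
  have hcmp : ∀ y ∈ win x a 0, y ∈ TMC E → ∀ y' ∈ win x' a' 0, y' ∈ TMC E →
      ν (pastOf y) (x 0) ≤ (1 + γ m) * ν (pastOf y') (x' 0) := by
    intro y hyw hy y' hyw' hy'
    have hedge : ∀ z, z ∈ win x a 0 → (pastOf z 0, x 0) ∈ E := fun z hz => by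
      have h1 := hz (-1) (by omega) (by norm_num)
      have h2 := hx (-1)
      simp only [pastOf, Nat.cast_zero, sub_zero, h1]
      simpa using h2
    have hedge' : (pastOf y' 0, x' 0) ∈ E := by
      have h1 := hyw' (-1) (by omega) (by norm_num)
      have h2 := hx' (-1)
      simp only [pastOf, Nat.cast_zero, sub_zero, h1]
      simpa using h2
    have hpos := (hν _ (isPast_pastOf hy') _ hedge').1
    have hb := hγ m hm _ _ (isPast_pastOf hy) (isPast_pastOf hy') (fun i hi => by
      simp only [pastOf]
      rw [hyw _ (by omega) (by omega), hyw' _ (by omega) (by omega)]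
      exact hag _ (by omega) (by omega)) (x 0) (hedge y hyw)
    have := (abs_le.1 hb).2
    rw [h0] at this ⊢
    rw [sub_le_iff_le_add', div_le_iff₀ hpos] at this
    exact this
  have hstep : ∀ y' ∈ win x' a' 0, y' ∈ TMC E →
      μ.real (win x a 1) ≤ (1 + γ m) * ν (pastOf y') (x' 0) * μ.real (win x a 0) := by
    intro y' hyw' hy'
    rw [← he]
    have : ∫ _ in win x a 0, (1 + γ m) * ν (pastOf y') (x' 0) ∂μ
        = (1 + γ m) * ν (pastOf y') (x' 0) * μ.real (win x a 0) := by
      rw [setIntegral_const, smul_eq_mul, mul_comm]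
    rw [← this]
    refine integral_mono_ae hi (integrable_const _) ?_
    rw [EventuallyLE, ae_restrict_iff' (measurableSet_win _ _ _)]
    filter_upwards [ae_mem_TMC hg] with y hy hyw using hcmp y hyw hy y' hyw' hy'
  calc μ.real (win x a 1) * μ.real (win x' a' 0)
      = ∫ _ in win x' a' 0, μ.real (win x a 1) ∂μ := by
        rw [setIntegral_const, smul_eq_mul, mul_comm]
    _ ≤ ∫ y' in win x' a' 0, ((1 + γ m) * μ.real (win x a 0)) * ν (pastOf y') (x' 0) ∂μ := by
        refine integral_mono_ae (integrable_const _) (hi'.const_mul _) ?_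
        rw [EventuallyLE, ae_restrict_iff' (measurableSet_win _ _ _)]
        filter_upwards [ae_mem_TMC hg] with y hy hyw
        have := hstep y hyw hy
        linarith
    _ = (1 + γ m) * (μ.real (win x' a' 1) * μ.real (win x a 0)) := by
        rw [integral_const_mul, he']; ring

/-- Bounded distortion of window measures, with constants tending to `1` with the length of the
common past. -/
theorem exists_distortion [Finite G] (hg : GoodMeasure E μ) (hc : CCSD E μ) :
    ∃ C : ℕ → ℝ, (∀ m, 1 ≤ C m) ∧ Tendsto C atTop (𝓝 1) ∧
      ∀ m : ℕ, 1 ≤ m → ∀ x ∈ TMC E, ∀ x' ∈ TMC E, ∀ a a' t b : ℤ, a ≤ t - m → a' ≤ t - m →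
        t ≤ b → (∀ i, t - m ≤ i → i < b → x i = x' i) →
        μ.real (win x a b) * μ.real (win x' a' t)
          ≤ C m * (μ.real (win x' a' b) * μ.real (win x a t)) := by
  obtain ⟨ν, hν, γ, hsum, hγ⟩ := hc
  have hsum' : Summable fun j => |γ j| := hsum.abs
  refine ⟨fun m => Real.exp (∑' j, |γ (j + m)|), fun m => ?_, ?_, ?_⟩
  · exact Real.one_le_exp (tsum_nonneg fun j => abs_nonneg _)
  · have := (Real.continuous_exp.tendsto 0).comp (tendsto_sum_nat_add fun j => |γ j|)
    simpa [Function.comp_def] using this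
  intro m hm x hx x' hx' a a' t b ha ha' htb hag
  obtain ⟨n, rfl⟩ := Int.le.dest htb
  have hstep : ∀ n : ℕ, (∀ i, t - m ≤ i → i < t + (n + 1 : ℕ) → x i = x' i) →
      μ.real (win x a (t + (n + 1 : ℕ))) * μ.real (win x' a' (t + n))
      ≤ Real.exp |γ (n + m)| *
        (μ.real (win x' a' (t + (n + 1 : ℕ))) * μ.real (win x a (t + n))) := by
    intro n hag
    have h := win_ratio_step_zero hg hν hγ (m := n + m) (by omega)
      (shiftBy_mem_TMC hx (t + n)) (shiftBy_mem_TMC hx' (t + n))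
      (a := a - (t + n)) (a' := a' - (t + n)) (by push_cast; omega) (by push_cast; omega)
      (fun i h1 h2 => hag _ (by push_cast at h1; omega) (by push_cast; omega))
    simp only [real_win_shiftBy hg.2.1, sub_add_cancel, zero_add] at h
    rw [show 1 + (t + (n : ℤ)) = t + (n + 1 : ℕ) by push_cast; ring] at h
    refine h.trans (mul_le_mul_of_nonneg_right ?_
      (mul_nonneg measureReal_nonneg measureReal_nonneg))
    have := Real.add_one_le_exp |γ (n + m)|
    have := le_abs_self (γ (n + m))
    linarith
  have key : μ.real (win x a (t + n)) * μ.real (win x' a' t)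
      ≤ Real.exp (∑ j ∈ Finset.range n, |γ (j + m)|) *
        (μ.real (win x' a' (t + n)) * μ.real (win x a t)) := by
    clear htb
    induction n with
    | zero => simp [mul_comm]
    | succ n ih =>
      have ih := ih fun i h1 h2 => hag i h1 (by push_cast at h2 ⊢; omega)
      have hs := hstep n fun i h1 h2 => hag i h1 h2
      rw [Finset.sum_range_succ, Real.exp_add]
      set A := μ.real (win x a (t + (n + 1 : ℕ)))
      set A' := μ.real (win x' a' (t + (n + 1 : ℕ)))
      have hB : 0 < μ.real (win x a (t + n)) := real_win_pos hg hx _ _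
      have hB' : 0 < μ.real (win x' a' (t + n)) := real_win_pos hg hx' _ _
      set B := μ.real (win x a (t + n))
      set B' := μ.real (win x' a' (t + n))
      have hD : 0 ≤ μ.real (win x a t) := measureReal_nonneg
      have hA' : 0 ≤ A' := measureReal_nonneg
      have hm2 := mul_le_mul hs ih (by positivity) (by positivity)
      refine le_of_mul_le_mul_right ?_ (mul_pos hB hB')
      calc _ = _ := by ring
        _ ≤ _ := hm2
        _ = _ := by ring
  refine key.trans (mul_le_mul_of_nonneg_right (Real.exp_le_exp.2 ?_)
    (mul_nonneg measureReal_nonneg measureReal_nonneg))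
  exact ((summable_nat_add_iff m).2 hsum').sum_le_tsum _ fun j _ => abs_nonneg _

/-- Finite energy: changing an interior block of bounded length changes the measure of a window
by a bounded factor. -/
theorem exists_finite_energy [Finite G] (hg : GoodMeasure E μ) (hc : CCSD E μ) (ℓ : ℕ) :
    ∃ δ : ℝ, 0 < δ ∧ δ ≤ 1 ∧ ∀ x ∈ TMC E, ∀ x' ∈ TMC E, ∀ t b : ℤ, 1 ≤ t → t + ℓ + 1 ≤ b →
      (∀ i, 0 ≤ i → i < b → (i < t ∨ t + ℓ ≤ i) → x i = x' i) →
      δ * μ.real (win x' 0 b) ≤ μ.real (win x 0 b) := by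
  have := hg.1
  obtain ⟨C, hC1, -, hC⟩ := exists_distortion hg hc
  obtain ⟨δ₀, hδ₀, hδ₀1, hmin⟩ := exists_pos_le_real_cyl μ (ℓ + 2)
  have hCp : 0 < C 1 := zero_lt_one.trans_le (hC1 1)
  refine ⟨δ₀ / (C 1 * C 1), by positivity, ?_, ?_⟩
  · rw [div_le_one (by positivity)]
    nlinarith [hC1 1]
  intro x hx x' hx' t b ht hb hag
  have h1 := hC 1 le_rfl x' hx' x hx 0 0 (t + ℓ + 1) b (by push_cast; omega) (by push_cast; omega)
    hb (fun i h1 h2 => (hag i (by push_cast at h1; omega) h2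
      (Or.inr (by push_cast at h1; omega))).symm)
  have h2 := hC 1 le_rfl x hx x hx (t - 1) 0 t (t + ℓ + 1) (by push_cast; omega)
    (by push_cast; omega) (by omega) (fun _ _ _ => rfl)
  have h3 : δ₀ ≤ μ.real (win x (t - 1) (t + ℓ + 1)) := by
    have h := real_win_shiftBy hg.2.1 x 0 (ℓ + 2 : ℕ) (t - 1)
    have hp := real_win_pos hg hx (t - 1) (t + ℓ + 1)
    rw [show 0 + (t - 1) = t - 1 by ring,
      show ((ℓ + 2 : ℕ) : ℤ) + (t - 1) = t + ℓ + 1 by push_cast; ring] at h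
    rw [← h, win_eq_cyl] at hp ⊢
    exact hmin _ hp.ne'
  have h4 : μ.real (win x (t - 1) t) ≤ 1 := measureReal_le_one
  have h5 : μ.real (win x' 0 (t + ℓ + 1)) ≤ μ.real (win x 0 t) := by
    rw [win_congr (x := x) (y := x') fun i h1 h2 => hag i h1 (by omega) (Or.inl h2)]
    exact measureReal_mono (win_subset _ (by omega))
  have hp' := real_win_pos hg hx' 0 (t + ℓ + 1)
  have hq : 0 < μ.real (win x 0 (t + ℓ + 1)) := real_win_pos hg hx _ _
  have hb' : 0 ≤ μ.real (win x' 0 b) := measureReal_nonneg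
  have hb'' : 0 ≤ μ.real (win x 0 b) := measureReal_nonneg
  have h6 : δ₀ * μ.real (win x' 0 (t + ℓ + 1)) ≤ C 1 * μ.real (win x 0 (t + ℓ + 1)) :=
    calc _ ≤ μ.real (win x (t - 1) (t + ℓ + 1)) * μ.real (win x 0 t) :=
          mul_le_mul h3 h5 hp'.le measureReal_nonneg
      _ ≤ _ := h2
      _ ≤ _ := mul_le_mul_of_nonneg_left (mul_le_of_le_one_right hq.le h4) hCp.le
  rw [div_mul_eq_mul_div, div_le_iff₀ (by positivity)]
  refine le_of_mul_le_mul_right ?_ hp'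
  calc δ₀ * μ.real (win x' 0 b) * μ.real (win x' 0 (t + ℓ + 1))
      = μ.real (win x' 0 b) * (δ₀ * μ.real (win x' 0 (t + ℓ + 1))) := by ring
    _ ≤ μ.real (win x' 0 b) * (C 1 * μ.real (win x 0 (t + ℓ + 1))) :=
        mul_le_mul_of_nonneg_left h6 hb'
    _ = C 1 * (μ.real (win x' 0 b) * μ.real (win x 0 (t + ℓ + 1))) := by ring
    _ ≤ C 1 * (C 1 * (μ.real (win x 0 b) * μ.real (win x' 0 (t + ℓ + 1)))) :=
        mul_le_mul_of_nonneg_left h1 hCp.le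
    _ = _ := by ring

end Distortion

section Algebra
variable {G : Type*}

/-- Every transition occurs in a point of the chain. -/
theorem exists_mem_TMC_edge {E : Set (G × G)} (hE : EveryLetterOccurs E)
    {a b : G} (h : (a, b) ∈ E) :
    ∃ x ∈ TMC E, x 0 = a ∧ x 1 = b := by
  obtain ⟨x, hx, i, hi⟩ := hE a
  obtain ⟨y, hy, j, hj⟩ := hE b
  refine ⟨fun n => if n ≤ 0 then x (i + n) else y (j + n - 1), fun n => ?_, by simp [hi],
    by simp [hj]⟩
  dsimp only
  rcases lt_trichotomy n 0 with hn | rfl | hn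
  · rw [if_pos hn.le, if_pos (by omega), ← add_assoc]
    exact hx _
  · simpa [hi, hj] using h
  · rw [if_neg (by omega), if_neg (by omega), show j + (n + 1) - 1 = j + n - 1 + 1 by ring]
    exact hy _

theorem closed_of_SC {E : Set (G × G)} (hE : EveryLetterOccurs E) {φ : G → G → G} (hSC : SC E φ)
    {e e' : G × G}
    (he : e ∈ E) (he' : e' ∈ E) : (φ e.1 e'.1, φ e.2 e'.2) ∈ E := by
  obtain ⟨x, hx, hx0, hx1⟩ := exists_mem_TMC_edge hE (a := e.1) (b := e.2) he
  obtain ⟨y, hy, hy0, hy1⟩ := exists_mem_TMC_edge hE (a := e'.1) (b := e'.2) he'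
  have := hSC x hx y hy 0
  simpa [hx0, hx1, hy0, hy1] using this

variable [AddCommGroup G]

/-- The translations preserving the transition set. -/
def edgeGroup (E : Set (G × G)) : AddSubgroup (G × G) where
  carrier := {d | ∀ e, e ∈ E ↔ e + d ∈ E}
  zero_mem' := fun e => by simp
  add_mem' := fun {d d'} h h' e => by rw [h e, h' (e + d), add_assoc]
  neg_mem' := fun {d} h e => by rw [h (e + -d), neg_add_cancel_right]

/-- The sequences all of whose transitions are translations of the transition set. -/
def diffGroup (E : Set (G × G)) : AddSubgroup (ℤ → G) where
  carrier := {d | ∀ i, (d i, d (i + 1)) ∈ edgeGroup E}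
  zero_mem' := fun _ => (edgeGroup E).zero_mem
  add_mem' := fun h h' i => (edgeGroup E).add_mem (h i) (h' i)
  neg_mem' := fun h i => (edgeGroup E).neg_mem (h i)

/-- The finitely supported elements of `diffGroup E`. -/
def homoclinicGroup (E : Set (G × G)) : AddSubgroup (ℤ → G) where
  carrier := {d | d ∈ diffGroup E ∧ ∃ M : ℕ, ∀ i, d i ≠ 0 → -(M : ℤ) ≤ i ∧ i < M}
  zero_mem' := ⟨(diffGroup E).zero_mem, 0, fun i hi => absurd rfl hi⟩
  add_mem' := by
    rintro d d' ⟨h, M, hM⟩ ⟨h', M', hM'⟩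
    refine ⟨(diffGroup E).add_mem h h', M + M', fun i hi => ?_⟩
    by_cases hd : d i = 0
    · have := hM' i fun h0 => hi (by simp [hd, h0])
      push_cast; omega
    · have := hM i hd
      push_cast; omega
  neg_mem' := by
    rintro d ⟨h, M, hM⟩
    exact ⟨(diffGroup E).neg_mem h, M, fun i hi => hM i fun h0 => hi (by simp [h0])⟩

variable {E : Set (G × G)}

theorem add_mem_TMC {x d : ℤ → G} (hx : x ∈ TMC E) (hd : d ∈ diffGroup E) : x + d ∈ TMC E :=
  fun i => (hd i (x i, x (i + 1))).1 (hx i)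

theorem shiftBy_mem_homoclinicGroup {d : ℤ → G} (hd : d ∈ homoclinicGroup E) (k : ℤ) :
    shiftBy k d ∈ homoclinicGroup E := by
  obtain ⟨h, M, hM⟩ := hd
  refine ⟨fun i => ?_, M + k.natAbs, fun i hi => ?_⟩
  · have := h (i + k)
    rwa [show i + k + 1 = i + 1 + k by ring] at this
  · have := hM (i + k) hi
    omega

/-- An affine injection preserving a finite set together with all its translates by differences
forces these differences to stabilize the set. -/
theorem map_sub_mem_stabilizer {A : Type*} [AddCommGroup A] {S : Set A} (hS : S.Finite)
    {f g : A ≃+ A} {c : A} (h : ∀ e ∈ S, ∀ e' ∈ S, f e + g e' + c ∈ S) {e₁ e₂ : A} (h₁ : e₁ ∈ S)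
    (h₂ : e₂ ∈ S) (e : A) (he : e ∈ S) : e + f (e₁ - e₂) ∈ S := by
  have hmaps : Set.MapsTo (fun e' => f e₂ + g e' + c) S S := fun e' he' => h e₂ h₂ e' he'
  have hinj : Set.InjOn (fun e' => f e₂ + g e' + c) S := fun a _ b _ hab => by simpa using hab
  obtain ⟨e', he', rfl⟩ :=
    ((hS.injOn_iff_bijOn_of_mapsTo hmaps).1 hinj).surjOn he
  have := h e₁ h₁ e' he'
  rw [map_sub]
  convert this using 1
  dsimp only
  abel

theorem map_sub_mem_edgeGroup [Finite G] {f g : (G × G) ≃+ (G × G)} {c : G × G}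
    (h : ∀ e ∈ E, ∀ e' ∈ E, f e + g e' + c ∈ E) {e₁ e₂ : G × G} (h₁ : e₁ ∈ E) (h₂ : e₂ ∈ E) :
    f (e₁ - e₂) ∈ edgeGroup E := by
  intro e
  refine ⟨map_sub_mem_stabilizer E.toFinite h h₁ h₂ e, fun he => ?_⟩
  have := map_sub_mem_stabilizer E.toFinite h h₂ h₁ _ he
  rwa [← neg_sub e₁, map_neg, add_neg_cancel_right] at this

theorem sub_mem_edgeGroup [Finite G] {f g : (G × G) ≃+ (G × G)} {c : G × G}
    (h : ∀ e ∈ E, ∀ e' ∈ E, f e + g e' + c ∈ E) {e₁ e₂ : G × G} (h₁ : e₁ ∈ E) (h₂ : e₂ ∈ E) :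
    e₁ - e₂ ∈ edgeGroup E := by
  have hmaps : Set.MapsTo (fun e => f e + g e₁ + c) E E := fun e he => h e he _ h₁
  have hinj : Set.InjOn (fun e => f e + g e₁ + c) E := fun a _ b _ hab => by simpa using hab
  have hs := ((E.toFinite.injOn_iff_bijOn_of_mapsTo hmaps).1 hinj).surjOn
  obtain ⟨e₁', h₁', he₁⟩ := hs h₁
  obtain ⟨e₂', h₂', he₂⟩ := hs h₂
  have := map_sub_mem_edgeGroup h h₁' h₂'
  rw [← he₁, ← he₂]
  simpa using this

theorem map_mem_edgeGroup_iff [Finite G] {f g : (G × G) ≃+ (G × G)} {c : G × G}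
    (h : ∀ e ∈ E, ∀ e' ∈ E, f e + g e' + c ∈ E) (hne : E.Nonempty) (d : G × G) :
    f d ∈ edgeGroup E ↔ d ∈ edgeGroup E := by
  have hfwd : Set.MapsTo f (edgeGroup E : Set (G × G)) (edgeGroup E) := by
    intro d hd
    obtain ⟨e, he⟩ := hne
    have := map_sub_mem_edgeGroup h ((hd e).1 he) he
    simpa using this
  refine ⟨fun hd => ?_, fun hd => hfwd hd⟩
  obtain ⟨d', hd', he⟩ :=
    (((Set.toFinite _).injOn_iff_bijOn_of_mapsTo hfwd).1 f.injective.injOn).surjOn hd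
  rwa [← f.injective he]

/-- The structure of a chain that is structurally compatible with an affine rule. -/
structure AffineChain (E : Set (G × G)) (η ρ : G ≃+ G) : Prop where
  sub_mem : ∀ x ∈ TMC E, ∀ x' ∈ TMC E, x - x' ∈ diffGroup E
  eta_iff : ∀ d, (η ∘ d ∈ homoclinicGroup E ↔ d ∈ homoclinicGroup E)
  rho_iff : ∀ d, (ρ ∘ d ∈ homoclinicGroup E ↔ d ∈ homoclinicGroup E)

theorem comp_mem_homoclinicGroup_iff {f : G ≃+ G}
    (hf : ∀ a b : G, (f a, f b) ∈ edgeGroup E ↔ (a, b) ∈ edgeGroup E) (d : ℤ → G) :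
    f ∘ d ∈ homoclinicGroup E ↔ d ∈ homoclinicGroup E := by
  refine and_congr (forall_congr' fun i => hf _ _) ?_
  simp

theorem affineChain_of_SC [Finite G] {η ρ : G ≃+ G} {c : G} (hE : EveryLetterOccurs E)
    {φ : G → G → G} (hSC : SC E φ)
    (hφ : ∀ a b, φ a b = η a + ρ b + c) (hne : E.Nonempty) : AffineChain E η ρ := by
  have h1 : ∀ e ∈ E, ∀ e' ∈ E,
      (η.prodCongr η) e + (ρ.prodCongr ρ) e' + ((c, c) : G × G) ∈ E := by
    intro e he e' he'
    have := closed_of_SC hE hSC he he'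
    simp only [hφ] at this
    exact this
  have h2 : ∀ e ∈ E, ∀ e' ∈ E,
      (ρ.prodCongr ρ) e + (η.prodCongr η) e' + ((c, c) : G × G) ∈ E := by
    intro e he e' he'
    rw [add_comm ((ρ.prodCongr ρ) e)]
    exact h1 e' he' e he
  exact ⟨fun x hx x' hx' i => sub_mem_edgeGroup h1 (hx i) (hx' i),
    comp_mem_homoclinicGroup_iff fun a b => map_mem_edgeGroup_iff h1 hne (a, b),
    comp_mem_homoclinicGroup_iff fun a b => map_mem_edgeGroup_iff h2 hne (a, b)⟩

end Algebra

section Expansion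

/-- Lucas' congruence for a base `p ^ r`. -/
theorem choose_pow_mul_add_modEq {p : ℕ} (hp : p.Prime) (r q j : ℕ) {d e : ℕ} (hd : d < p ^ r)
    (he : e < p ^ r) :
    (p ^ r * q + d).choose (p ^ r * j + e) ≡ q.choose j * d.choose e [MOD p] := by
  have := Fact.mk hp
  induction r generalizing d e with
  | zero =>
    obtain rfl : d = 0 := by simpa using hd
    obtain rfl : e = 0 := by simpa using he
    simp [Nat.ModEq.refl]
  | succ r ih =>
    have hmod : ∀ q d, (p ^ (r + 1) * q + d) % p = d % p := fun q d => by
      rw [pow_succ', mul_assoc, Nat.mul_add_mod]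
    have hdiv : ∀ q d, (p ^ (r + 1) * q + d) / p = p ^ r * q + d / p := fun q d => by
      rw [pow_succ', mul_assoc, Nat.mul_add_div hp.pos]
    have hlt : ∀ {d}, d < p ^ (r + 1) → d / p < p ^ r := fun h =>
      Nat.div_lt_of_lt_mul (by rwa [pow_succ'] at h)
    have h1 := Choose.choose_modEq_choose_mod_mul_choose_div_nat (p := p)
      (n := p ^ (r + 1) * q + d) (k := p ^ (r + 1) * j + e)
    have h2 := Choose.choose_modEq_choose_mod_mul_choose_div_nat (p := p) (n := d) (k := e)
    rw [hmod, hmod, hdiv, hdiv] at h1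
    calc _ ≡ _ [MOD p] := h1
      _ ≡ (d % p).choose (e % p) * (q.choose j * (d / p).choose (e / p)) [MOD p] :=
        (ih (hlt hd) (hlt he)).mul_left _
      _ = q.choose j * ((d % p).choose (e % p) * (d / p).choose (e / p)) := by ring
      _ ≡ _ [MOD p] := h2.symm.mul_left _

theorem addChar_sum {A ι : Type*} [AddCommMonoid A] (χ : AddChar A ℂ) (s : Finset ι) (f : ι → A) :
    χ (∑ i ∈ s, f i) = ∏ i ∈ s, χ (f i) := by
  classical
  induction s using Finset.induction_on with
  | empty => simp
  | insert i s hi ih => rw [Finset.sum_insert hi, Finset.prod_insert hi, χ.map_add_eq_mul, ih]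

variable {G : Type*} [AddCommGroup G]

/-- The linear part of an affine cellular automaton. -/
def linCA (η ρ : G ≃+ G) (x : ℤ → G) : ℤ → G := fun i => η (x i) + ρ (x (i + 1))

/-- The action of the monomial `η ^ j (ρ σ) ^ i`. -/
def monoCA (η ρ : G ≃+ G) (i j : ℕ) (x : ℤ → G) : ℤ → G := fun n => η^[j] (ρ^[i] (x (n + i)))

theorem linCA_shiftBy (η ρ : G ≃+ G) (k : ℤ) (x : ℤ → G) :
    linCA η ρ (shiftBy k x) = shiftBy k (linCA η ρ x) := by
  funext i
  simp only [linCA, shiftBy]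
  rw [show i + 1 + k = i + k + 1 by ring]

theorem iterate_linCA_shiftBy (η ρ : G ≃+ G) (m : ℕ) (k : ℤ) (x : ℤ → G) :
    (linCA η ρ)^[m] (shiftBy k x) = shiftBy k ((linCA η ρ)^[m] x) :=
  Function.Commute.iterate_left (f := linCA η ρ) (g := shiftBy k)
    (fun y => linCA_shiftBy η ρ k y) m x

theorem monoCA_shiftBy (η ρ : G ≃+ G) (i j : ℕ) (t : ℤ) (h : ℤ → G) :
    monoCA η ρ i j (shiftBy (-t) h) = shiftBy (-(t - i)) (η^[j] ∘ ρ^[i] ∘ h) := by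
  funext n
  simp only [monoCA, shiftBy, Function.comp]
  rw [show n + i + -t = n + -(t - i) by ring]

theorem iterate_linCA_apply_eq_zero (η ρ : G ≃+ G) (m : ℕ) {x : ℤ → G} {a b : ℤ}
    (hx : ∀ i, a ≤ i → i < b + m → x i = 0) (i : ℤ) (h1 : a ≤ i) (h2 : i < b) :
    (linCA η ρ)^[m] x i = 0 := by
  induction m generalizing x with
  | zero => exact hx i h1 (by simpa using h2)
  | succ m ih =>
    rw [Function.iterate_succ_apply]
    refine ih fun k hk hk' => ?_
    simp only [linCA]
    rw [hx k hk (by push_cast; omega), hx (k + 1) (by omega) (by push_cast; omega)]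
    simp

/-- The linear part as an additive endomorphism. -/
def linEnd (η ρ : G ≃+ G) : AddMonoid.End (ℤ → G) where
  toFun := linCA η ρ
  map_zero' := by funext i; simp [linCA]
  map_add' x y := by funext i; simp only [linCA, Pi.add_apply, map_add]; abel

theorem linEnd_pow_apply (η ρ : G ≃+ G) (m : ℕ) (x : ℤ → G) :
    (linEnd η ρ ^ m) x = (linCA η ρ)^[m] x := by
  rw [AddMonoid.End.coe_pow]; rfl

theorem iterate_linCA_add (η ρ : G ≃+ G) (m : ℕ) (x y : ℤ → G) :
    (linCA η ρ)^[m] (x + y) = (linCA η ρ)^[m] x + (linCA η ρ)^[m] y := by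
  simp only [← linEnd_pow_apply, map_add]

theorem iterate_linCA_eq_sum {η ρ : G ≃+ G} (hcomm : ∀ a, η (ρ a) = ρ (η a)) (m : ℕ)
    (x : ℤ → G) :
    (linCA η ρ)^[m] x = ∑ i ∈ Finset.range (m + 1), m.choose i • monoCA η ρ i (m - i) x := by
  let A : AddMonoid.End (ℤ → G) :=
    { toFun := fun x n => η (x n)
      map_zero' := by funext; simp
      map_add' := fun x y => by funext; simp }
  let B : AddMonoid.End (ℤ → G) :=
    { toFun := fun x n => ρ (x (n + 1))
      map_zero' := by funext; simp
      map_add' := fun x y => by funext; simp }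
  have hAB : linEnd η ρ = B + A := by
    ext x n
    exact add_comm _ _
  have hc : Commute B A := by
    ext x n
    exact (hcomm _).symm
  have hA : ∀ j x n, (A ^ j) x n = η^[j] (x n) := by
    intro j
    induction j with
    | zero => intro x n; rfl
    | succ j ih =>
      intro x n
      rw [pow_succ', Function.iterate_succ_apply', ← ih]
      rfl
  have hB : ∀ i x n, (B ^ i) x n = ρ^[i] (x (n + i)) := by
    intro i
    induction i with
    | zero => intro x n; simp
    | succ i ih =>
      intro x n
      rw [pow_succ', Function.iterate_succ_apply']
      change ρ ((B ^ i) x (n + 1)) = _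
      rw [ih]
      congr 3
      push_cast
      ring
  rw [← linEnd_pow_apply, hAB, hc.add_pow]
  refine (AddMonoidHom.finsetSum_apply _ _ x).trans (Finset.sum_congr rfl fun i _ => ?_)
  rw [(hc.pow_pow i (m - i)).eq, ← nsmul_eq_mul']
  change m.choose i • (A ^ (m - i)) ((B ^ i) x) = _
  congr 1
  funext n
  rw [hA, hB]
  rfl

theorem addChar_iterate_linCA {η ρ : G ≃+ G} (hcomm : ∀ a, η (ρ a) = ρ (η a))
    (χ : AddChar (ℤ → G) ℂ) (m : ℕ) (x : ℤ → G) :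
    χ ((linCA η ρ)^[m] x)
      = ∏ i ∈ Finset.range (m + 1), χ (monoCA η ρ i (m - i) x) ^ m.choose i := by
  rw [iterate_linCA_eq_sum hcomm, addChar_sum]
  simp only [AddChar.map_nsmul_eq_pow]

end Expansion

section Sites
variable {G : Type*} [AddCommGroup G] {E : Set (G × G)} {η ρ : G ≃+ G}

/-- `h` is supported in `[t, t + ℓ)`. -/
def SuppIn (h : ℤ → G) (t : ℤ) (ℓ : ℕ) : Prop := ∀ i, h i ≠ 0 → t ≤ i ∧ i < t + ℓ

theorem SuppIn.shiftBy {h : ℤ → G} {t : ℤ} {ℓ : ℕ} (hh : SuppIn h t ℓ) (k : ℤ) :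
    SuppIn (shiftBy k h) (t - k) ℓ := fun i hi => by
  have := hh (i + k) hi
  omega

/-- The elements of order dividing `N` of the homoclinic group, supported in `[0, ℓ)`. -/
def blockSet (E : Set (G × G)) (N ℓ : ℕ) : Set (ℤ → G) :=
  {h | h ∈ homoclinicGroup E ∧ N • h = 0 ∧ SuppIn h 0 ℓ}

/-- A local character with support in `[0, K)` which is trivial on the translates of the
`N`-torsion blocks left of site `a`, but not at site `a`. -/
structure LeadingSite (E : Set (G × G)) (χ : AddChar (ℤ → G) ℂ) (N p ℓ a K : ℕ) : Prop where
  locality : ∀ x, (∀ i : ℤ, 0 ≤ i → i < K → x i = 0) → χ x = 1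
  one_le : 1 ≤ a
  lt : a < K
  prime : p.Prime
  torsion : ∀ h ∈ homoclinicGroup E, N • h = 0 → χ (p • h) = 1
  low : ∀ h ∈ blockSet E N ℓ, ∀ t : ℤ, t < a → χ (shiftBy (-t) h) = 1
  lead : ∃ h ∈ blockSet E N ℓ, χ (shiftBy (-a) h) ≠ 1

theorem nsmul_shiftBy (N : ℕ) (k : ℤ) (h : ℤ → G) : N • shiftBy k h = shiftBy k (N • h) := rfl

theorem AffineChain.iterate_mem_iff (hA : AffineChain E η ρ) (i j : ℕ) (d : ℤ → G) :
    η^[j] ∘ ρ^[i] ∘ d ∈ homoclinicGroup E ↔ d ∈ homoclinicGroup E := by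
  have h1 : ∀ j d, η^[j] ∘ d ∈ homoclinicGroup E ↔ d ∈ homoclinicGroup E := by
    intro j
    induction j with
    | zero => intro d; rfl
    | succ j ih =>
      intro d
      rw [Function.iterate_succ', Function.comp_assoc, hA.eta_iff, ih]
  have h2 : ∀ j d, ρ^[j] ∘ d ∈ homoclinicGroup E ↔ d ∈ homoclinicGroup E := by
    intro j
    induction j with
    | zero => intro d; rfl
    | succ j ih =>
      intro d
      rw [Function.iterate_succ', Function.comp_assoc, hA.rho_iff, ih]
  rw [h1, h2]

theorem iterate_comp_nsmul (i j N : ℕ) (d : ℤ → G) :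
    N • (η^[j] ∘ ρ^[i] ∘ d) = η^[j] ∘ ρ^[i] ∘ (N • d) := by
  funext n
  simp only [Pi.smul_apply, Function.comp, iterate_map_nsmul]

theorem iterate_comp_mem_blockSet_iff (hA : AffineChain E η ρ) {N ℓ : ℕ} (i j : ℕ) (d : ℤ → G) :
    η^[j] ∘ ρ^[i] ∘ d ∈ blockSet E N ℓ ↔ d ∈ blockSet E N ℓ := by
  have hinj : Function.Injective (η^[j] ∘ ρ^[i]) :=
    (η.injective.iterate j).comp (ρ.injective.iterate i)
  have h0 : (η^[j] ∘ ρ^[i]) 0 = 0 := by simp [iterate_map_zero]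
  refine and_congr (hA.iterate_mem_iff i j d) (and_congr ?_ ?_)
  · rw [iterate_comp_nsmul]
    constructor
    · intro h
      funext n
      exact hinj ((congrFun h n).trans h0.symm)
    · intro h
      rw [h]
      funext n
      exact h0
  · refine forall_congr' fun n => ?_
    rw [show (η^[j] ∘ ρ^[i] ∘ d) n = (η^[j] ∘ ρ^[i]) (d n) from rfl, ← h0, hinj.ne_iff, h0]

variable {χ : AddChar (ℤ → G) ℂ} {N p ℓ a K : ℕ}

theorem LeadingSite.pow_prime (hχ : LeadingSite E χ N p ℓ a K) {h : ℤ → G}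
    (hh : h ∈ blockSet E N ℓ) (t : ℤ) : χ (shiftBy t h) ^ p = 1 := by
  rw [← AddChar.map_nsmul_eq_pow]
  refine hχ.torsion _ (shiftBy_mem_homoclinicGroup hh.1 t) ?_
  rw [nsmul_shiftBy, hh.2.1]
  rfl

theorem LeadingSite.high (hχ : LeadingSite E χ N p ℓ a K) {h : ℤ → G}
    (hh : h ∈ blockSet E N ℓ) {t : ℤ} (ht : K ≤ t) : χ (shiftBy (-t) h) = 1 :=
  hχ.locality _ fun i _ h2 => by
    by_contra hne
    have := hh.2.2 _ hne
    omega

theorem pow_eq_one_of_dvd {ζ : ℂ} {p k : ℕ} (h : ζ ^ p = 1) (hk : p ∣ k) : ζ ^ k = 1 := by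
  obtain ⟨c, rfl⟩ := hk
  rw [pow_mul, h, one_pow]

theorem pow_ne_one_of_not_dvd {ζ : ℂ} {p k : ℕ} (hp : p.Prime) (h : ζ ^ p = 1) (hζ : ζ ≠ 1)
    (hk : ¬ p ∣ k) : ζ ^ k ≠ 1 := by
  have := Fact.mk hp
  rw [Ne, ← orderOf_dvd_iff_pow_eq_one, orderOf_eq_prime h hζ]
  exact hk

/-- For `m = p ^ r * q + d` the character `χ ∘ L ^ m` is nontrivial on a block at every site
`a + p ^ r * j` for which `q.choose j` is not divisible by `p`. -/
theorem LeadingSite.exists_block (hχ : LeadingSite E χ N p ℓ a K) (hA : AffineChain E η ρ)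
    (hcomm : ∀ a, η (ρ a) = ρ (η a)) {r q d j : ℕ} (hd : d + K < p ^ r) (hj : j ≤ q)
    (hndvd : ¬ p ∣ q.choose j) :
    ∃ h ∈ homoclinicGroup E, SuppIn h (a + p ^ r * j : ℕ) ℓ ∧
      χ ((linCA η ρ)^[p ^ r * q + d] h) ^ p = 1 ∧ χ ((linCA η ρ)^[p ^ r * q + d] h) ≠ 1 := by
  set D := p ^ r with hD
  set m := D * q + d with hm
  have hDj : D * j ≤ D * q := Nat.mul_le_mul_left _ hj
  obtain ⟨h₁, hh₁, hne⟩ := hχ.lead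
  obtain ⟨h₀, rfl⟩ : ∃ h₀ : ℤ → G, η^[m - D * j] ∘ ρ^[D * j] ∘ h₀ = h₁ := by
    have hs : Function.Surjective (η^[m - D * j] ∘ ρ^[D * j]) :=
      (η.surjective.iterate _).comp (ρ.surjective.iterate _)
    choose g hg using hs
    exact ⟨g ∘ h₁, funext fun n => hg (h₁ n)⟩
  have hh₀ := (iterate_comp_mem_blockSet_iff hA _ _ _).1 hh₁
  have hval : χ ((linCA η ρ)^[m] (shiftBy (-((a + D * j : ℕ) : ℤ)) h₀))
      = χ (shiftBy (-a) (η^[m - D * j] ∘ ρ^[D * j] ∘ h₀)) ^ m.choose (D * j) := by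
    rw [addChar_iterate_linCA hcomm, Finset.prod_eq_single (D * j)]
    · rw [monoCA_shiftBy]
      congr 4
      push_cast; ring
    · intro i hi hij
      rw [monoCA_shiftBy]
      have hmem := (iterate_comp_mem_blockSet_iff (N := N) (ℓ := ℓ) hA i (m - i) h₀).2 hh₀
      rcases lt_or_gt_of_ne hij with hlt | hgt
      · by_cases hfar : i + K ≤ D * j
        · rw [hχ.high hmem (by push_cast [← hD]; zify at hfar; linarith), one_pow]
        · refine pow_eq_one_of_dvd (hχ.pow_prime hmem _) ?_
          obtain ⟨e, he⟩ := Nat.exists_eq_add_of_lt hlt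
          obtain ⟨j', rfl⟩ : ∃ j', j = j' + 1 := Nat.exists_eq_succ_of_ne_zero (by
            rintro rfl; simp at hlt)
          have hie : i = D * j' + (D - (e + 1)) := by
            have : D * (j' + 1) = D * j' + D := by ring
            omega
          have hl := choose_pow_mul_add_modEq hχ.prime r q j' (d := d) (e := D - (e + 1))
            (by omega) (by omega)
          rw [← hD, ← hie, Nat.choose_eq_zero_of_lt (by omega : d < D - (e + 1)), mul_zero] at hl
          exact (Nat.modEq_zero_iff_dvd).1 hl
      · rw [hχ.low _ hmem _ (by push_cast [← hD]; zify at hgt; linarith), one_pow]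
    · intro hn
      exact absurd (Finset.mem_range.2 (by omega)) hn
  refine ⟨shiftBy (-((a + D * j : ℕ) : ℤ)) h₀, shiftBy_mem_homoclinicGroup hh₀.1 _, ?_, ?_, ?_⟩
  · have := hh₀.2.2.shiftBy (-((a + D * j : ℕ) : ℤ))
    simpa using this
  · rw [hval, pow_right_comm, hχ.pow_prime hh₁, one_pow]
  · rw [hval]
    refine pow_ne_one_of_not_dvd hχ.prime (hχ.pow_prime hh₁ _) hne fun hdv => hndvd ?_
    have hl := choose_pow_mul_add_modEq hχ.prime r q j (d := d) (e := 0) (by omega) (by omega)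
    rw [← hD, add_zero, Nat.choose_zero_right, mul_one] at hl
    exact (hl.dvd_iff dvd_rfl).1 hdv

theorem exists_norm_one_add_le {p : ℕ} (hp : p ≠ 0) :
    ∃ c : ℝ, 0 < c ∧ c ≤ 2 ∧ ∀ ζ : ℂ, ζ ^ p = 1 → ζ ≠ 1 → ‖ζ‖ = 1 ∧ ‖1 + ζ‖ ≤ 2 - c := by
  classical
  let S : Finset ℂ := (Polynomial.nthRootsFinset p (1 : ℂ)).erase 1
  have hS : ∀ ζ : ℂ, ζ ^ p = 1 → ζ ≠ 1 → ζ ∈ S := fun ζ h1 h2 =>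
    Finset.mem_erase.2 ⟨h2, (Polynomial.mem_nthRootsFinset (Nat.pos_of_ne_zero hp) _).2 h1⟩
  have hS' : ∀ ζ ∈ S, ‖ζ‖ = 1 ∧ ‖1 + ζ‖ < 2 := by
    intro ζ hζ
    obtain ⟨h1, h2⟩ := Finset.mem_erase.1 hζ
    have hn : ‖ζ‖ = 1 := Complex.norm_eq_one_of_pow_eq_one
      ((Polynomial.mem_nthRootsFinset (Nat.pos_of_ne_zero hp) _).1 h2) hp
    refine ⟨hn, ?_⟩
    have := norm_add_lt_of_not_sameRay (x := (1 : ℂ)) (y := ζ) fun hs => h1 ?_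
    · rw [hn, norm_one] at this
      linarith
    · have := (sameRay_iff_norm_smul_eq.1 hs)
      simpa [hn] using this
  by_cases hne : S.Nonempty
  · obtain ⟨z, hz, hmax⟩ := S.exists_max_image (fun ζ => ‖1 + ζ‖) hne
    exact ⟨2 - ‖1 + z‖, by linarith [(hS' z hz).2], by linarith [norm_nonneg (1 + z)],
      fun ζ h1 h2 => ⟨(hS' ζ (hS ζ h1 h2)).1, by linarith [hmax ζ (hS ζ h1 h2)]⟩⟩
  · exact ⟨1, one_pos, one_le_two, fun ζ h1 h2 => absurd ⟨ζ, hS ζ h1 h2⟩ hne⟩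

end Sites

/-- The restriction of a sequence to `[0, B)`. -/
def restrictWord {A : Type*} (B : ℕ) (x : ℤ → A) : Fin B → A := fun i => x ((i : ℕ) : ℤ)

theorem cyl_eq_preimage {A : Type*} {B : ℕ} (z : Fin B → A) : cyl z = restrictWord B ⁻¹' {z} := by
  ext x
  exact funext_iff.symm

theorem measurable_restrictWord {A : Type*} [MeasurableSpace A] (B : ℕ) :
    Measurable (restrictWord B : (ℤ → A) → Fin B → A) :=
  measurable_pi_lambda _ fun _ => measurable_pi_apply _

section Decay
variable {G : Type*} [AddCommGroup G] {E : Set (G × G)}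

theorem win_add_congr {x y h : ℤ → G} {a b : ℤ} (hx : x ∈ win (y + h) a b) :
    win (y + h) a b = win x a b ∧ win y a b = win (x + -h) a b :=
  ⟨(win_congr fun i h1 h2 => (hx i h1 h2)).symm, win_congr fun i h1 h2 => by
    simp [hx i h1 h2]⟩

/-- The extension of a finite word by zeros. -/
def extendZero {B : ℕ} (z : Fin B → G) : ℤ → G := fun i =>
  if h : 0 ≤ i ∧ i < B then z ⟨i.toNat, by omega⟩ else 0

theorem extendZero_add {B : ℕ} (z z' : Fin B → G) :
    extendZero (z + z') = extendZero z + extendZero z' := by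
  funext i
  simp only [extendZero, Pi.add_apply]
  split_ifs <;> simp

theorem extendZero_natCast {B : ℕ} (z : Fin B → G) (i : Fin B) :
    extendZero z ((i : ℕ) : ℤ) = z i := by
  have := i.2
  simp [extendZero]

theorem extendZero_restrictWord (B : ℕ) (x : ℤ → G) {i : ℤ} (h0 : 0 ≤ i) (h1 : i < B) :
    extendZero (restrictWord B x) i = x i := by
  simp [extendZero, restrictWord, h0, h1]

theorem extendZero_restrictWord_of_suppIn {B : ℕ} {h : ℤ → G} {t ℓ : ℕ} (hh : SuppIn h t ℓ)
    (hB : t + ℓ ≤ B) : extendZero (restrictWord B h) = h := by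
  funext i
  by_cases hi : 0 ≤ i ∧ i < B
  · exact extendZero_restrictWord B h hi.1 hi.2
  · simp only [extendZero, dif_neg hi]
    by_contra hne
    have := hh i (Ne.symm hne)
    omega

/-- The words of length `B` vanishing on `[0, t)`. -/
def prefixZero (G : Type*) [AddCommGroup G] (B t : ℕ) : AddSubgroup (Fin B → G) where
  carrier := {z | ∀ i : Fin B, (i : ℕ) < t → z i = 0}
  zero_mem' := fun _ _ => rfl
  add_mem' := fun h h' i hi => by simp [h i hi, h' i hi]
  neg_mem' := fun h i hi => by simp [h i hi]

theorem win_extendZero {B : ℕ} (z : Fin B → G) (t : ℕ) :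
    win (extendZero z) 0 (min t B : ℕ) = {x | restrictWord B x - z ∈ prefixZero G B t} := by
  ext x
  constructor
  · intro hx i hi
    have := hx ((i : ℕ) : ℤ) (by positivity) (by have := i.2; omega)
    rw [extendZero_natCast] at this
    simp [restrictWord, this]
  · intro hx i h0 h1
    have := hx ⟨i.toNat, by omega⟩ (by simp only; omega)
    simp only [restrictWord, Pi.sub_apply, sub_eq_zero] at this
    rw [show ((i.toNat : ℕ) : ℤ) = i by omega] at this
    rw [this]
    simp only [extendZero, dif_pos (show 0 ≤ i ∧ i < B by omega)]

theorem norm_addChar_eq_one [Finite G] (χ : AddChar (ℤ → G) ℂ) (x : ℤ → G) : ‖χ x‖ = 1 := by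
  refine Complex.norm_eq_one_of_pow_eq_one (n := Nat.card G) ?_ Nat.card_pos.ne'
  rw [← AddChar.map_nsmul_eq_pow]
  have : Nat.card G • x = 0 := by
    funext i
    exact card_nsmul_eq_zero'
  rw [this, AddChar.map_zero_eq_one]

variable [MeasurableSpace G] [MeasurableSingletonClass G] {μ : Measure (ℤ → G)}

theorem exists_energy_homoclinic [Finite G] (hg : GoodMeasure E μ) (hc : CCSD E μ) (ℓ : ℕ) :
    ∃ δ : ℝ, 0 < δ ∧ δ ≤ 1 ∧ ∀ (y : ℤ → G), ∀ h ∈ homoclinicGroup E, ∀ t b : ℤ, SuppIn h t ℓ →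
      1 ≤ t → t + ℓ + 1 ≤ b → δ * μ.real (win (y + h) 0 b) ≤ μ.real (win y 0 b) := by
  obtain ⟨δ, hδ, hδ1, hδe⟩ := exists_finite_energy hg hc ℓ
  refine ⟨δ, hδ, hδ1, fun y h hh t b hs ht hb => ?_⟩
  by_cases h0 : μ.real (win (y + h) 0 b) = 0
  · rw [h0, mul_zero]; exact measureReal_nonneg
  · obtain ⟨x, hx, hxE⟩ := exists_mem_TMC_of_pos hg h0
    obtain ⟨h1, h2⟩ := win_add_congr hx
    rw [h1, h2]
    refine hδe _ (add_mem_TMC hxE ((homoclinicGroup E).neg_mem hh).1) x hxE t b ht hb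
      fun i _ _ hi => ?_
    have : h i = 0 := by
      by_contra hne
      have := hs i hne
      omega
    simp [this]

theorem exists_distortion_homoclinic [Finite G] (hg : GoodMeasure E μ) (hc : CCSD E μ) :
    ∃ C : ℕ → ℝ, (∀ m, 1 ≤ C m) ∧ Tendsto C atTop (𝓝 1) ∧
      ∀ m : ℕ, 1 ≤ m → ∀ (y : ℤ → G), ∀ h ∈ homoclinicGroup E, ∀ (ℓ : ℕ) (t b b' : ℤ),
        SuppIn h t ℓ → 0 ≤ t → t + ℓ + m ≤ b → b ≤ b' →
        μ.real (win (y + h) 0 b') * μ.real (win y 0 b)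
          ≤ C m * (μ.real (win y 0 b') * μ.real (win (y + h) 0 b)) := by
  obtain ⟨C, hC1, hC, hCd⟩ := exists_distortion hg hc
  refine ⟨C, hC1, hC, fun m hm y h hh ℓ t b b' hs ht hb hb' => ?_⟩
  have hnn : 0 ≤ C m * (μ.real (win y 0 b') * μ.real (win (y + h) 0 b)) :=
    mul_nonneg (zero_le_one.trans (hC1 m)) (mul_nonneg measureReal_nonneg measureReal_nonneg)
  by_cases h0 : μ.real (win (y + h) 0 b') = 0
  · rwa [h0, zero_mul]
  · obtain ⟨x, hx, hxE⟩ := exists_mem_TMC_of_pos hg h0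
    obtain ⟨h1, h2⟩ := win_add_congr hx
    obtain ⟨h3, h4⟩ := win_add_congr (win_subset _ hb' hx)
    rw [h1, h2, h3, h4]
    refine hCd m hm x hxE _ (add_mem_TMC hxE ((homoclinicGroup E).neg_mem hh).1) 0 0 b b'
      (by omega) (by omega) hb' fun i hi _ => ?_
    have : h i = 0 := by
      by_contra hne
      have := hs i hne
      omega
    simp [this]

theorem cosetSum_prefixZero [Fintype G] [IsFiniteMeasure μ] {B : ℕ} (t : ℕ) (z : Fin B → G) :
    cosetSum (fun z => μ.real (cyl z)) (prefixZero G B t) z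
      = μ.real (win (extendZero z) 0 (min t B : ℕ)) := by
  classical
  rw [win_extendZero]
  have h := sum_measureReal_preimage_singleton (μ := μ) (f := restrictWord B)
    (Finset.univ.filter fun s => s - z ∈ prefixZero G B t)
    fun y _ => measurable_restrictWord B (measurableSet_singleton y)
  have hset : restrictWord B ⁻¹' ((Finset.univ.filter fun s => s - z ∈ prefixZero G B t :
      Finset (Fin B → G)) : Set (Fin B → G))
      = {x | restrictWord B x - z ∈ prefixZero G B t} := by
    ext x; simp
  rw [hset] at h
  rw [← h, cosetSum]
  refine Finset.sum_equiv (Equiv.addLeft z) (fun d => ?_) fun d _ => ?_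
  · simp
  · rw [cyl_eq_preimage]; rfl

theorem integral_addChar_iterate [Fintype G] [IsFiniteMeasure μ] {η ρ : G ≃+ G}
    {χ : AddChar (ℤ → G) ℂ} {K : ℕ}
    (hloc : ∀ x, (∀ i : ℤ, 0 ≤ i → i < K → x i = 0) → χ x = 1) {m B : ℕ} (hB : K + m ≤ B) :
    ∫ x, χ ((linCA η ρ)^[m] x) ∂μ
      = ∑ z : Fin B → G, (μ.real (cyl z) : ℂ) * χ ((linCA η ρ)^[m] (extendZero z)) := by
  have hfac : ∀ x, χ ((linCA η ρ)^[m] x)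
      = χ ((linCA η ρ)^[m] (extendZero (restrictWord B x))) := by
    intro x
    have hx : x = extendZero (restrictWord B x) + (x - extendZero (restrictWord B x)) := by abel
    have h1 : χ ((linCA η ρ)^[m] (x - extendZero (restrictWord B x))) = 1 :=
      hloc _ fun i h0 h1 => iterate_linCA_apply_eq_zero η ρ m (a := 0) (b := K)
        (fun i h0 h1 => by
          rw [Pi.sub_apply, extendZero_restrictWord B x h0 (by omega), sub_self]) i h0 h1
    conv_lhs => rw [hx, iterate_linCA_add, χ.map_add_eq_mul, h1, mul_one]
  rw [integral_congr_ae (Eventually.of_forall hfac)]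
  rw [← integral_map (f := fun z => χ ((linCA η ρ)^[m] (extendZero z)))
    (measurable_restrictWord B).aemeasurable Integrable.of_finite.aestronglyMeasurable,
    integral_fintype Integrable.of_finite]
  refine Finset.sum_congr rfl fun z _ => ?_
  rw [map_measureReal_apply (measurable_restrictWord B) (measurableSet_singleton z),
    cyl_eq_preimage, Complex.real_smul]

theorem LeadingSite.cesaroNull [Fintype G] (hg : GoodMeasure E μ) (hc : CCSD E μ) {η ρ : G ≃+ G}
    (hA : AffineChain E η ρ) (hcomm : ∀ a, η (ρ a) = ρ (η a)) {χ : AddChar (ℤ → G) ℂ}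
    {N p ℓ a K : ℕ} (hχ : LeadingSite E χ N p ℓ a K) :
    CesaroNull fun m => ‖∫ x, χ ((linCA η ρ)^[m] x) ∂μ‖ := by
  have := hg.1
  obtain ⟨δ, hδ, hδ1, hener⟩ := exists_energy_homoclinic hg hc ℓ
  obtain ⟨C, hC1, hC, hdist⟩ := exists_distortion_homoclinic hg hc
  obtain ⟨c, hc0, hc2, hroot⟩ := exists_norm_one_add_le hχ.prime.ne_zero
  set β := c * δ / 2 with hβ
  have hβ0 : 0 < β := by positivity
  have hβ1 : β ≤ 1 := by nlinarith
  have hp := hχ.prime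
  have ha := hχ.one_le
  have haK := hχ.lt
  have hnorm : ∀ m, ‖∫ x, χ ((linCA η ρ)^[m] x) ∂μ‖ ≤ 1 := fun m => by
    simpa using norm_integral_le_of_norm_le_const (μ := μ) (C := 1)
      (Eventually.of_forall fun x => (norm_addChar_eq_one χ ((linCA η ρ)^[m] x)).le)
  refine cesaroNull_of_blocks (fun m => norm_nonneg _) hnorm fun ε hε => ?_
  obtain ⟨r, hr1, hr2, hr3⟩ : ∃ r : ℕ, ℓ + 1 ≤ p ^ r ∧ ((K : ℕ) : ℝ) ≤ ε * (p ^ r : ℕ) ∧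
      (C (p ^ r - ℓ) - 1) / β ≤ ε := by
    have hpow : Tendsto (fun r : ℕ => p ^ r) atTop atTop :=
      tendsto_pow_atTop_atTop_of_one_lt hp.one_lt
    have h1 := hpow.eventually_ge_atTop (ℓ + 1)
    have h2 := ((tendsto_natCast_atTop_atTop (R := ℝ)).comp hpow).eventually_ge_atTop (K / ε)
    have h3 : ∀ᶠ k in atTop, (C k - 1) / β < ε := by
      have : Tendsto (fun k => (C k - 1) / β) atTop (𝓝 0) := by
        simpa using (hC.sub_const 1).div_const β
      exact this.eventually (gt_mem_nhds hε)
    have h4 := ((tendsto_sub_atTop_nat ℓ).comp hpow).eventually h3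
    obtain ⟨r, hr1, hr2, hr3⟩ := (h1.and (h2.and h4)).exists
    refine ⟨r, hr1, ?_, hr3.le⟩
    simp only [Function.comp] at hr2
    rwa [div_le_iff₀' hε] at hr2
  set D := p ^ r with hD
  refine ⟨D, K, fun q => (1 - β) ^ nzChoose p q, by omega, hr2,
    fun q => pow_nonneg (by linarith) _, cesaroNull_pow_nzChoose hp hβ0 hβ1, fun q d hd => ?_⟩
  set m := D * q + d with hm
  set B := K + m + ℓ + 1 with hB
  rw [integral_addChar_iterate hχ.locality (show K + m ≤ B by omega)]
  have hchain := norm_cosetSum_chain (W := Fin B → G) (w := fun z => μ.real (cyl z))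
    (ψ := fun z => χ ((linCA η ρ)^[m] (extendZero z))) (K := fun j => prefixZero G B (a + D * j))
    (δ := δ) (c := c) (C := C (D - ℓ)) (fun z => measureReal_nonneg)
    (fun z => (norm_addChar_eq_one _ _).le)
    (fun j j' hj z hz i hi => hz i (hi.trans_le (by gcongr))) hδ hδ1 hc0 hc2 (hC1 _) (q + 1)
    ((Finset.range (q + 1)).filter fun j => ¬ p ∣ q.choose j) ?_
  · have hcard : (((Finset.range (q + 1)).filter fun j => ¬ p ∣ q.choose j).filter
        (· < q + 1)).card = nzChoose p q := by
      rw [nzChoose, Finset.filter_true_of_mem]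
      intro j hj
      exact Finset.mem_range.1 (Finset.mem_filter.1 hj).1
    have hsum : ∑ z : Fin B → G, μ.real (cyl z) = 1 := by
      simp only [cyl_eq_preimage]
      rw [sum_measureReal_preimage_singleton _
        fun y _ => measurable_restrictWord B (measurableSet_singleton y)]
      simp
    rw [hcard, hsum, mul_one] at hchain
    refine hchain.trans ?_
    rw [add_comm]
    exact add_le_add hr3 le_rfl
  · intro j hj _
    obtain ⟨hjr, hjp⟩ := Finset.mem_filter.1 hj
    have hjq : j ≤ q := Nat.lt_succ_iff.1 (Finset.mem_range.1 hjr)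
    have hDj : D * j ≤ D * q := Nat.mul_le_mul_left _ hjq
    obtain ⟨h, hh, hs, hζp, hζ1⟩ := hχ.exists_block hA hcomm hd hjq hjp
    rw [← hD] at hs
    set ζ := χ ((linCA η ρ)^[m] h) with hζ
    obtain ⟨hn, hn'⟩ := hroot ζ hζp hζ1
    have hext : extendZero (restrictWord B h) = h :=
      extendZero_restrictWord_of_suppIn hs (by omega)
    have hneg : -h ∈ homoclinicGroup E := (homoclinicGroup E).neg_mem hh
    have hsneg : SuppIn (-h) (a + D * j : ℕ) ℓ := fun i hi => hs i fun h0 => hi (by simp [h0])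
    have hDj1 : D * (j + 1) = D * j + D := by ring
    have hsub : ∀ z : Fin B → G, extendZero z = extendZero (z + restrictWord B h) + -h := by
      intro z; rw [extendZero_add, hext]; abel
    have hcyl : ∀ z : Fin B → G, cyl z = win (extendZero z) 0 (B : ℕ) := by
      intro z
      rw [win_eq_cyl]
      congr 1
      funext i
      exact (extendZero_natCast z i).symm
    have hmin : a + D * j + ℓ + 1 ≤ min (a + D * (j + 1)) B := le_min (by omega) (by omega)
    have hdist' : ∀ y : ℤ → G, ∀ h ∈ homoclinicGroup E, SuppIn h (a + D * j : ℕ) ℓ →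
        μ.real (win (y + h) 0 (B : ℕ)) * μ.real (win y 0 (min (a + D * (j + 1)) B : ℕ))
          ≤ C (D - ℓ) * (μ.real (win y 0 (B : ℕ)) *
            μ.real (win (y + h) 0 (min (a + D * (j + 1)) B : ℕ))) := by
      intro y h hh hs
      rcases le_total (a + D * (j + 1)) B with hle | hle
      · rw [min_eq_left hle]
        exact hdist (D - ℓ) (by omega) y h hh ℓ _ _ _ hs (by positivity) (by omega)
          (by exact_mod_cast hle)
      · rw [min_eq_right hle, mul_comm]
        exact le_mul_of_one_le_left (mul_nonneg measureReal_nonneg measureReal_nonneg) (hC1 _)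
    refine ⟨restrictWord B h, ?_, ζ, hn, hn', ?_, ?_, ?_, ?_, ?_⟩
    · intro i hi
      by_contra hne
      have := hs _ hne
      omega
    · intro z
      rw [extendZero_add, hext, iterate_linCA_add, χ.map_add_eq_mul, mul_comm]
    · intro z
      rw [cosetSum_prefixZero, cosetSum_prefixZero]
      conv_lhs => rw [hsub z]
      exact hener _ _ hneg _ _ hsneg (by omega) (by exact_mod_cast hmin)
    · intro z
      rw [cosetSum_prefixZero, cosetSum_prefixZero, extendZero_add, hext]
      exact hener _ _ hh _ _ hs (by omega) (by exact_mod_cast hmin)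
    · intro z
      rw [cosetSum_prefixZero, cosetSum_prefixZero, hcyl z, hcyl (z + restrictWord B h),
        extendZero_add, hext]
      exact hdist' _ h hh hs
    · intro z
      have := hdist' (extendZero (z + restrictWord B h)) (-h) hneg hsneg
      rw [← hsub z] at this
      rwa [cosetSum_prefixZero, cosetSum_prefixZero, hcyl z, hcyl (z + restrictWord B h)]

end Decay

theorem shiftBy_shiftBy {A : Type*} (a b : ℤ) (x : ℤ → A) :
    shiftBy a (shiftBy b x) = shiftBy (a + b) x := by
  funext i
  simp only [shiftBy, add_assoc]

theorem shiftBy_zero {A : Type*} (x : ℤ → A) : shiftBy 0 x = x := by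
  funext i
  simp only [shiftBy, add_zero]

section Mixing
variable {G : Type*} [AddCommGroup G] {E : Set (G × G)}

/-- A character depending on finitely many coordinates. -/
def IsLocal (χ : AddChar (ℤ → G) ℂ) : Prop :=
  ∃ M : ℕ, ∀ x, (∀ i : ℤ, -M ≤ i → i < M → x i = 0) → χ x = 1

/-- The translate of a character. -/
def shiftChar (k : ℤ) (χ : AddChar (ℤ → G) ℂ) : AddChar (ℤ → G) ℂ where
  toFun x := χ (shiftBy k x)
  map_zero_eq_one' := χ.map_zero_eq_one
  map_add_eq_mul' x y := χ.map_add_eq_mul (shiftBy k x) (shiftBy k y)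

theorem shiftChar_apply (k : ℤ) (χ : AddChar (ℤ → G) ℂ) (x : ℤ → G) :
    shiftChar k χ x = χ (shiftBy k x) := rfl

theorem nsmul_mem_homoclinicGroup {h : ℤ → G} (hh : h ∈ homoclinicGroup E) (n : ℕ) :
    n • h ∈ homoclinicGroup E := (homoclinicGroup E).nsmul_mem hh n

/-- A local character which is nontrivial on the homoclinic group has a translate with a
leading site. -/
theorem IsLocal.exists_leadingSite [Finite G] {χ : AddChar (ℤ → G) ℂ} (hχ : IsLocal χ)
    (hne : ∃ h ∈ homoclinicGroup E, χ h ≠ 1) :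
    ∃ (k : ℤ) (N p ℓ a K : ℕ), LeadingSite E (shiftChar k χ) N p ℓ a K := by
  classical
  obtain ⟨K₀, hloc⟩ := hχ
  have hex : ∃ N : ℕ, 1 ≤ N ∧ ∃ h ∈ homoclinicGroup E, N • h = 0 ∧ χ h ≠ 1 := by
    obtain ⟨h, hh, h1⟩ := hne
    exact ⟨Nat.card G, Nat.card_pos, h, hh, funext fun i => card_nsmul_eq_zero', h1⟩
  obtain ⟨N, ⟨hN, h₁, hh₁, hNh, hχh⟩, hmin⟩ : ∃ N : ℕ,
      (1 ≤ N ∧ ∃ h ∈ homoclinicGroup E, N • h = 0 ∧ χ h ≠ 1) ∧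
      ∀ N' < N, ¬ (1 ≤ N' ∧ ∃ h ∈ homoclinicGroup E, N' • h = 0 ∧ χ h ≠ 1) :=
    ⟨Nat.find hex, Nat.find_spec hex, fun _ => Nat.find_min hex⟩
  have hN1 : N ≠ 1 := by
    rintro rfl
    rw [one_smul] at hNh
    rw [hNh, χ.map_zero_eq_one] at hχh
    exact hχh rfl
  have hp := Nat.minFac_prime hN1
  obtain ⟨_, M, hM⟩ := id hh₁
  have hblock : shiftBy (-M) h₁ ∈ blockSet E N (2 * M) := by
    refine ⟨shiftBy_mem_homoclinicGroup hh₁ _, by rw [nsmul_shiftBy, hNh]; rfl, fun i hi => ?_⟩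
    have := hM _ hi
    push_cast
    omega
  have hbdd : ∀ t : ℤ, (∃ h ∈ blockSet E N (2 * M), χ (shiftBy (-t) h) ≠ 1) →
      -((K₀ : ℤ) + 2 * M) ≤ t ∧ t < K₀ := by
    rintro t ⟨h, hh, h1⟩
    by_contra hcon
    refine h1 (hloc _ fun i h0 h1 => ?_)
    by_contra hz
    have := hh.2.2 _ hz
    push_cast at this
    omega
  obtain ⟨a₀, hlead, hlow⟩ := Int.exists_least_of_bdd
    ⟨_, fun t ht => (hbdd t ht).1⟩ ⟨-M, shiftBy (-M) h₁, hblock, by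
      rwa [shiftBy_shiftBy, show - -(M : ℤ) + -M = 0 by ring, shiftBy_zero]⟩
  have ha₀ := hbdd a₀ hlead
  obtain ⟨a, ha⟩ := Int.eq_ofNat_of_zero_le (show 0 ≤ a₀ + (K₀ + 2 * M + 1) by omega)
  have htr : ∀ t h, shiftChar (K₀ + 2 * M + 1) χ (shiftBy (-t) h)
      = χ (shiftBy (-(t - (K₀ + 2 * M + 1))) h) := by
    intro t h
    rw [shiftChar_apply, shiftBy_shiftBy]
    congr 2
    ring
  refine ⟨K₀ + 2 * M + 1, N, N.minFac, 2 * M, a, 2 * K₀ + 2 * M + 1,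
    ⟨fun x hx => hloc _ fun i h0 h1 => hx _ ?_ ?_, by omega, by omega, hp, fun h hh hN' => ?_,
      fun h hh t ht => ?_, ?_⟩⟩
  · omega
  · push_cast; omega
  · rw [shiftChar_apply, ← nsmul_shiftBy]
    by_contra h1
    obtain ⟨q, hq⟩ := Nat.minFac_dvd N
    have hq0 : 1 ≤ q := Nat.pos_of_ne_zero (by rintro rfl; omega)
    refine hmin q ?_ ⟨hq0, _,
      nsmul_mem_homoclinicGroup (shiftBy_mem_homoclinicGroup hh (K₀ + 2 * M + 1)) N.minFac, ?_, h1⟩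
    · conv_rhs => rw [hq]
      exact (Nat.lt_mul_iff_one_lt_left hq0).2 hp.one_lt
    · rw [← mul_smul, mul_comm q, ← hq, nsmul_shiftBy, hN']
      rfl
  · rw [htr]
    by_contra h1
    have := hlow _ ⟨h, hh, h1⟩
    omega
  · obtain ⟨h, hh, h1⟩ := hlead
    refine ⟨h, hh, ?_⟩
    rw [htr]
    convert h1 using 3
    omega

variable {η ρ : G ≃+ G} {c : G} {φ : G → G → G}

theorem iterate_CA_eq (hφ : ∀ a b, φ a b = η a + ρ b + c) (m : ℕ) (x : ℤ → G) :
    (CA φ)^[m] x = (linCA η ρ)^[m] x + (CA φ)^[m] 0 := by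
  induction m with
  | zero => simp
  | succ m ih =>
    rw [Function.iterate_succ_apply', Function.iterate_succ_apply', Function.iterate_succ_apply',
      ih]
    funext i
    simp only [CA, linCA, hφ, Pi.add_apply, map_add]
    abel

theorem isLocallyConstant_of_window {A B : Type*} [TopologicalSpace A] [DiscreteTopology A]
    {f : (ℤ → A) → B} (s : Finset ℤ) (hf : ∀ x y, (∀ i ∈ s, y i = x i) → f y = f x) :
    IsLocallyConstant f :=
  (IsLocallyConstant.iff_exists_open _).2 fun x =>
    ⟨⋂ i ∈ s, (fun y : ℤ → A => y i) ⁻¹' {x i},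
      isOpen_biInter_finset fun i _ => (isOpen_discrete {x i}).preimage (continuous_apply i),
      by simp, fun y hy => hf x y (Set.mem_iInter₂.1 hy)⟩

theorem continuous_of_isLocal [TopologicalSpace G] [DiscreteTopology G]
    {χ : AddChar (ℤ → G) ℂ} (hχ : IsLocal χ) : Continuous χ := by
  obtain ⟨M, hM⟩ := hχ
  refine (isLocallyConstant_of_window (Finset.Ico (-M : ℤ) M) fun x y hxy => ?_).continuous
  rw [show y = (y - x) + x by abel, χ.map_add_eq_mul, hM _ fun i h0 h1 => ?_, one_mul]
  exact sub_eq_zero.2 (hxy i (Finset.mem_Ico.2 ⟨h0, h1⟩))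

theorem continuous_CA {A : Type*} [TopologicalSpace A] [DiscreteTopology A] (φ : A → A → A) :
    Continuous (CA φ) :=
  continuous_pi fun i =>
    (continuous_of_discreteTopology (f := fun a : A × A => φ a.1 a.2)).comp
      (g := fun a : A × A => φ a.1 a.2) (f := fun x : ℤ → A => (x i, x (i + 1)))
      ((continuous_apply i).prodMk (continuous_apply (i + 1)))

theorem continuous_linCA [TopologicalSpace G] [DiscreteTopology G] : Continuous (linCA η ρ) :=
  continuous_CA fun a b => η a + ρ b

variable [MeasurableSpace G] [MeasurableSingletonClass G] {μ : Measure (ℤ → G)}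

/-- Mixing in the Cesàro sense along characters that see the homoclinic group. -/
theorem cesaroNull_of_isLocal [Fintype G] [TopologicalSpace G] [DiscreteTopology G]
    (hg : GoodMeasure E μ) (hc : CCSD E μ)
    (hA : AffineChain E η ρ) (hcomm : ∀ a, η (ρ a) = ρ (η a))
    (hφ : ∀ a b, φ a b = η a + ρ b + c) {χ : AddChar (ℤ → G) ℂ} (hχ : IsLocal χ)
    (hne : ∃ h ∈ homoclinicGroup E, χ h ≠ 1) :
    CesaroNull fun m => ‖∫ x, χ ((CA φ)^[m] x) ∂μ‖ := by
  obtain ⟨k, N, p, ℓ, a, K, hL⟩ := hχ.exists_leadingSite hne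
  convert hL.cesaroNull hg hc hA hcomm using 2 with m
  have hmeas : Measurable fun x => χ ((linCA η ρ)^[m] x) :=
    ((continuous_of_isLocal hχ).comp (continuous_linCA.iterate m)).measurable
  have h1 : ∫ x, χ ((CA φ)^[m] x) ∂μ
      = (∫ x, χ ((linCA η ρ)^[m] x) ∂μ) * χ ((CA φ)^[m] 0) := by
    rw [← integral_mul_const]
    refine integral_congr_ae (Eventually.of_forall fun x => ?_)
    beta_reduce
    rw [iterate_CA_eq hφ m x, χ.map_add_eq_mul]
  have h2 : ∫ x, χ ((linCA η ρ)^[m] x) ∂μ = ∫ x, shiftChar k χ ((linCA η ρ)^[m] x) ∂μ := by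
    conv_lhs => rw [← map_shiftBy hg.2.1 k]
    rw [integral_map (measurable_shiftBy k).aemeasurable hmeas.aestronglyMeasurable]
    refine integral_congr_ae (Eventually.of_forall fun x => ?_)
    beta_reduce
    rw [shiftChar_apply, iterate_linCA_shiftBy]
  rw [h1, h2, norm_mul, norm_addChar_eq_one, mul_one]

end Mixing

section Coding
variable {G F : Type*} {n : ℕ} {τ : Equiv.Perm F}

theorem ident_mem_hTMC (f : F) (y : ℤ → Fin n) : ident τ f y ∈ hTMC τ n := fun i => by
  simp only [ident, add_comm i 1, zpow_one_add]
  rfl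

theorem fst_eq_of_mem_hTMC {x : ℤ → F × Fin n} (hx : x ∈ hTMC τ n) (i : ℤ) :
    (x i).1 = (τ ^ i) (x 0).1 := by
  have hstep : ∀ i, (x (i + 1)).1 = τ (x i).1 := hx
  induction i with
  | zero => rfl
  | succ i ih => rw [hstep, ih, add_comm, zpow_one_add]; rfl
  | pred i ih =>
    apply τ.injective
    rw [← hstep, sub_add_cancel, ih, ← Equiv.Perm.mul_apply, ← zpow_one_add]
    congr 2
    ring

theorem eq_ident_of_mem_hTMC {x : ℤ → F × Fin n} (hx : x ∈ hTMC τ n) :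
    x = ident τ (x 0).1 fun i => (x i).2 :=
  funext fun i => Prod.ext (fst_eq_of_mem_hTMC hx i) rfl

theorem ident_injective {f f' : F} {y y' : ℤ → Fin n} (h : ident τ f y = ident τ f' y') :
    f = f' ∧ y = y' :=
  ⟨congrArg Prod.fst (congrFun h 0), funext fun i => congrArg Prod.snd (congrFun h i)⟩

/-- A letterwise conjugacy of the chain of `E` with `hTMC τ n` inducing `T` on the first
component. -/
structure Coding (E : Set (G × G)) (φ : G → G → G) (τ : Equiv.Perm F) (n : ℕ)
    (θ : G → F × Fin n) (T : F → F) : Prop where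
  bijOn : Set.BijOn (fun x => θ ∘ x) (TMC E) (hTMC τ n)
  mem : ∀ x ∈ TMC E, CA φ x ∈ TMC E
  step : ∀ x ∈ TMC E, (θ (CA φ x 0)).1 = T (θ (x 0)).1

theorem coding_of_regularSimpleData {E : Set (G × G)} {φ : G → G → G} (hSC : SC E φ) {k : ℕ}
    {op : (ℤ → F × Fin n) → (ℤ → F × Fin n) → (ℤ → F × Fin n)}
    {θ : G → F × Fin n} {oF : F → F → F} {oS : Fin n → Fin n → Fin n}
    (hRS : RegularSimpleData E φ τ n k op θ oF oS) :
    Coding E φ τ n θ fun f => oF f (τ f) := by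
  obtain ⟨-, -, -, -, ⟨hbij, hconj⟩, -, -, hop⟩ := hRS
  refine ⟨hbij, fun x hx => hSC x hx _ (shiftBy_mem_TMC hx 1), fun x hx => ?_⟩
  have hid := eq_ident_of_mem_hTMC (hbij.mapsTo hx)
  have hsh : shiftMap (θ ∘ x) = ident τ (τ (θ (x 0)).1) fun i => (θ (x (i + 1))).2 := by
    have := eq_ident_of_mem_hTMC (shiftBy_mem_TMC (hbij.mapsTo hx) 1)
    refine this.trans ?_
    congr 1
    exact hbij.mapsTo hx 0
  have h : θ ∘ CA φ x = op (θ ∘ x) (shiftMap (θ ∘ x)) := hconj x hx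
  rw [hsh, hid, hop] at h
  exact congrArg Prod.fst (congrFun h 0)

/-- The inverse of the coding, with values in the chain of `E`. -/
noncomputable def decode [Nonempty G] (E : Set (G × G)) (τ : Equiv.Perm F) (θ : G → F × Fin n)
    (f : F) (y : ℤ → Fin n) : ℤ → G :=
  Function.invFunOn (fun x => θ ∘ x) (TMC E) (ident τ f y)

namespace Coding
variable {E : Set (G × G)} {φ : G → G → G} {θ : G → F × Fin n} {T : F → F}

theorem iterate_mem (hθ : Coding E φ τ n θ T) {x : ℤ → G} (hx : x ∈ TMC E) (m : ℕ) :
    (CA φ)^[m] x ∈ TMC E := by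
  induction m with
  | zero => exact hx
  | succ m ih => rw [Function.iterate_succ_apply']; exact hθ.mem _ ih

theorem iterate_step (hθ : Coding E φ τ n θ T) {x : ℤ → G} (hx : x ∈ TMC E) (m : ℕ) :
    (θ ((CA φ)^[m] x 0)).1 = T^[m] (θ (x 0)).1 := by
  induction m with
  | zero => rfl
  | succ m ih =>
    rw [Function.iterate_succ_apply', Function.iterate_succ_apply',
      hθ.step _ (hθ.iterate_mem hx m), ih]

section Decode
variable [Nonempty G]

theorem decode_mem (hθ : Coding E φ τ n θ T) (f : F) (y : ℤ → Fin n) :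
    decode E τ θ f y ∈ TMC E :=
  Function.invFunOn_mem (hθ.bijOn.surjOn (ident_mem_hTMC f y))

theorem comp_decode (hθ : Coding E φ τ n θ T) (f : F) (y : ℤ → Fin n) :
    θ ∘ decode E τ θ f y = ident τ f y :=
  Function.invFunOn_eq (hθ.bijOn.surjOn (ident_mem_hTMC f y))

theorem decode_comp (hθ : Coding E φ τ n θ T) {x : ℤ → G} (hx : x ∈ TMC E) :
    decode E τ θ (θ (x 0)).1 (fun i => (θ (x i)).2) = x := by
  refine hθ.bijOn.injOn (hθ.decode_mem _ _) hx ?_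
  rw [hθ.comp_decode]
  exact (eq_ident_of_mem_hTMC (hθ.bijOn.mapsTo hx)).symm

theorem decode_injective (hθ : Coding E φ τ n θ T) {f f' : F} {y y' : ℤ → Fin n}
    (h : decode E τ θ f y = decode E τ θ f' y') : f = f' ∧ y = y' := by
  have := congrArg (fun x => θ ∘ x) h
  rw [hθ.comp_decode, hθ.comp_decode] at this
  exact ident_injective this

end Decode

theorem isClosed_TMC [TopologicalSpace G] [DiscreteTopology G] (E : Set (G × G)) :
    IsClosed (TMC E) := by
  have : TMC E = ⋂ i : ℤ, (fun x : ℤ → G => (x i, x (i + 1))) ⁻¹' E := by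
    ext x; simp [TMC]
  rw [this]
  exact isClosed_iInter fun i => (isClosed_discrete E).preimage
    ((continuous_apply i).prodMk (continuous_apply (i + 1)))

/-- The inverse of the coding is a sliding block code. -/
theorem exists_window [Finite G] (hθ : Coding E φ τ n θ T) :
    ∃ r : ℕ, ∀ x ∈ TMC E, ∀ x' ∈ TMC E, ∀ i : ℤ,
      (∀ j, i - r ≤ j → j ≤ i + r → θ (x j) = θ (x' j)) → x i = x' i := by
  let _ : TopologicalSpace G := ⊥
  have _ : DiscreteTopology G := ⟨rfl⟩
  suffices h : ∃ r : ℕ, ∀ x ∈ TMC E, ∀ x' ∈ TMC E,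
      (∀ j : ℤ, -r ≤ j → j ≤ r → θ (x j) = θ (x' j)) → x 0 = x' 0 by
    obtain ⟨r, hr⟩ := h
    refine ⟨r, fun x hx x' hx' i hi => ?_⟩
    have := hr _ (shiftBy_mem_TMC hx i) _ (shiftBy_mem_TMC hx' i) fun j h0 h1 =>
      hi (j + i) (by omega) (by omega)
    simpa [shiftBy] using this
  by_contra! hcon
  let C : ℕ → Set ((ℤ → G) × (ℤ → G)) := fun r =>
    (TMC E ×ˢ TMC E) ∩ ((⋂ j ∈ Set.Icc (-r : ℤ) r, {p | θ (p.1 j) = θ (p.2 j)}) ∩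
      {p | p.1 0 ≠ p.2 0})
  have hclosed : ∀ r, IsClosed (C r) := by
    intro r
    have hcl : ∀ (j : ℤ) (S : Set (G × G)),
        IsClosed {p : (ℤ → G) × (ℤ → G) | (p.1 j, p.2 j) ∈ S} := fun j S =>
      (isClosed_discrete S).preimage
        (((continuous_apply j).comp continuous_fst).prodMk
          ((continuous_apply j).comp continuous_snd))
    exact ((isClosed_TMC E).prod (isClosed_TMC E)).inter
      ((isClosed_biInter fun j _ => hcl j {e | θ e.1 = θ e.2}).inter (hcl 0 {e | e.1 ≠ e.2}))
  obtain ⟨⟨x, x'⟩, hx⟩ := IsCompact.nonempty_iInter_of_sequence_nonempty_isCompact_isClosed C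
    (fun r => by
      refine Set.inter_subset_inter_right _ (Set.inter_subset_inter_left _ ?_)
      refine Set.biInter_subset_biInter_left (Set.Icc_subset_Icc ?_ ?_) <;> push_cast <;> omega)
    (fun r => by
      obtain ⟨x, hx, x', hx', h1, h2⟩ := hcon r
      exact ⟨(x, x'), ⟨hx, hx'⟩, Set.mem_iInter₂.2 fun j hj => h1 j hj.1 hj.2, h2⟩)
    (hclosed 0).isCompact hclosed
  rw [Set.mem_iInter] at hx
  refine (hx 0).2.2 (congrFun (hθ.bijOn.injOn (hx 0).1.1 (hx 0).1.2 (funext fun j => ?_)) 0)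
  have := Set.mem_iInter₂.1 (hx j.natAbs).2.1 j ⟨by omega, by omega⟩
  exact this

end Coding
end Coding

section Bernoulli
variable (n : ℕ)

/-- The uniform Bernoulli measure. -/
noncomputable def bernoulli : Measure (ℤ → Fin n) :=
  Measure.infinitePi fun _ => ProbabilityTheory.uniformOn Set.univ

theorem uniformOn_univ_singleton (a : Fin n) :
    ProbabilityTheory.uniformOn (Set.univ : Set (Fin n)) {a} = (n : ℝ≥0∞)⁻¹ := by
  rw [ProbabilityTheory.uniformOn_univ, Measure.count_singleton, Fintype.card_fin, one_div]

variable [NeZero n]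

instance : IsProbabilityMeasure (ProbabilityTheory.uniformOn (Set.univ : Set (Fin n))) :=
  ProbabilityTheory.isProbabilityMeasure_uniformOn Set.finite_univ Set.univ_nonempty

instance : IsProbabilityMeasure (bernoulli n) := by
  unfold bernoulli; infer_instance

theorem bernoulli_cylinder (m : ℕ) (w : Fin m → Fin n) (j : ℤ) :
    bernoulli n {y : ℤ → Fin n | ∀ i : Fin m, y (j + ((i : ℕ) : ℤ)) = w i}
      = (n : ℝ≥0∞)⁻¹ ^ m := by
  classical
  let e : Fin m ↪ ℤ := ⟨fun i => j + ((i : ℕ) : ℤ), fun a b h => Fin.ext (by simpa using h)⟩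
  let t : ℤ → Set (Fin n) := fun l => {a | ∀ i : Fin m, e i = l → a = w i}
  have ht : ∀ i, t (e i) = {w i} := by
    intro i
    ext a
    exact ⟨fun h => h i rfl, fun h i' hi' => by rw [e.injective hi']; exact h⟩
  have hset : {y : ℤ → Fin n | ∀ i : Fin m, y (j + ((i : ℕ) : ℤ)) = w i}
      = Set.pi (Finset.univ.map e : Finset ℤ) t := by
    ext y
    simp only [Finset.coe_map, Finset.coe_univ, Set.image_univ, Set.mem_pi, Set.forall_mem_range,
      ht]
    rfl
  rw [hset, bernoulli, Measure.infinitePi_pi _ fun _ _ => MeasurableSet.of_discrete]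
  simp only [Finset.prod_map, ht, uniformOn_univ_singleton]
  simp

theorem map_add_right_bernoulli (v : ℤ → Fin n) :
    Measure.map (fun y => y + v) (bernoulli n) = bernoulli n := by
  rw [bernoulli]
  refine (Measure.infinitePi_map_pi _ (f := fun i a => a + v i)
    fun i => Measurable.of_discrete).trans ?_
  congr 1
  funext i
  refine Measure.ext_of_singleton fun a => ?_
  rw [Measure.map_apply Measurable.of_discrete (measurableSet_singleton a),
    show (fun b => b + v i) ⁻¹' {a} = {a - v i} by
      ext b; exact eq_sub_iff_add_eq.symm,
    uniformOn_univ_singleton, uniformOn_univ_singleton]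

/-- A function that picks up a nontrivial factor under a local injective rearrangement has
zero mean. -/
theorem integral_bernoulli_eq_zero {f : (ℤ → Fin n) → ℂ} (hf : Integrable f (bernoulli n))
    {U : (ℤ → Fin n) → ℤ → Fin n} (hU : Function.Injective U) (W : Finset ℤ)
    (hUW : ∀ y, ∀ i ∉ W, U y i = y i) {ζ : ℂ} (hζ : ζ ≠ 1) (hfU : ∀ y, f (U y) = ζ * f y) :
    ∫ y, f y ∂bernoulli n = 0 := by
  classical
  let e : (W → Fin n) → ℤ → Fin n := fun v i => if h : i ∈ W then v ⟨i, h⟩ else 0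
  have he : ∀ (v : ℤ → Fin n), (∀ i ∉ W, v i = 0) → e (fun i => v i) = v := by
    intro v hv
    funext i
    by_cases hi : i ∈ W
    · simp [e, hi]
    · simp [e, hi, hv i hi]
  have he0 : ∀ v, ∀ i ∉ W, e v i = 0 := fun v i hi => by simp [e, hi]
  have hinj : Function.Injective e := fun v v' h => by
    funext i
    have := congrFun h i
    simpa [e] using this
  have hzero : ∀ y, ∑ v, f (y + e v) = 0 := by
    intro y
    let π : (W → Fin n) → W → Fin n := fun v i => (U (y + e v) - y) i
    have hπ : ∀ v, y + e (π v) = U (y + e v) := by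
      intro v
      rw [he (U (y + e v) - y) fun i hi => ?_, add_sub_cancel]
      rw [Pi.sub_apply, hUW _ i hi, Pi.add_apply, he0 v i hi, add_zero, sub_self]
    have hbij : Function.Bijective π := Finite.injective_iff_bijective.1 fun v v' h => by
      have := hπ v
      rw [h, hπ v'] at this
      exact (hinj (add_left_cancel (hU this))).symm
    have h1 : ∑ v, f (y + e v) = ζ * ∑ v, f (y + e v) := by
      rw [Finset.mul_sum, ← hbij.sum_comp fun v => f (y + e v)]
      exact Finset.sum_congr rfl fun v _ => by rw [hπ, hfU]
    have h2 : (1 - ζ) * ∑ v, f (y + e v) = 0 := by rw [sub_mul, one_mul, ← h1, sub_self]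
    exact (mul_eq_zero.1 h2).resolve_left (sub_ne_zero.2 hζ.symm)
  have hmeas : ∀ v : ℤ → Fin n, Measurable fun y : ℤ → Fin n => y + v := fun v =>
    measurable_pi_lambda _ fun i => (Measurable.of_discrete (f := fun a => a + v i)).comp
      (measurable_pi_apply i)
  have htr : ∀ v, Integrable (fun y => f (y + v)) (bernoulli n) ∧
      ∫ y, f (y + v) ∂bernoulli n = ∫ y, f y ∂bernoulli n := by
    intro v
    rw [← map_add_right_bernoulli n v] at hf
    refine ⟨(integrable_map_measure hf.aestronglyMeasurable (hmeas v).aemeasurable).1 hf, ?_⟩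
    conv_rhs => rw [← map_add_right_bernoulli n v]
    rw [integral_map (hmeas v).aemeasurable hf.aestronglyMeasurable]
  have hsum : ∑ v : W → Fin n, ∫ y, f (y + e v) ∂bernoulli n = 0 := by
    rw [← integral_finsetSum _ fun v _ => (htr (e v)).1]
    simp only [hzero, integral_zero]
  simp only [(htr _).2, Finset.sum_const, nsmul_eq_mul] at hsum
  refine (mul_eq_zero.1 hsum).resolve_left ?_
  exact_mod_cast Finset.card_ne_zero.2 Finset.univ_nonempty

end Bernoulli

namespace Coding
section Decode
variable {G F : Type*} {n : ℕ} {τ : Equiv.Perm F} [AddCommGroup G] {E : Set (G × G)}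
  {φ : G → G → G} {θ : G → F × Fin n} {T : F → F}

theorem decode_eq_of_window {r : ℕ} (hθ : Coding E φ τ n θ T)
    (hr : ∀ x ∈ TMC E, ∀ x' ∈ TMC E, ∀ i : ℤ,
      (∀ j, i - r ≤ j → j ≤ i + r → θ (x j) = θ (x' j)) → x i = x' i)
    {f : F} {y y' : ℤ → Fin n} {i : ℤ} (h : ∀ j, i - r ≤ j → j ≤ i + r → y j = y' j) :
    decode E τ θ f y i = decode E τ θ f y' i := by
  refine hr _ (hθ.decode_mem f y) _ (hθ.decode_mem f y') i fun j h0 h1 => ?_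
  have h2 := congrFun (hθ.comp_decode f y) j
  have h3 := congrFun (hθ.comp_decode f y') j
  simp only [Function.comp] at h2 h3
  rw [h2, h3]
  simp only [ident, h j h0 h1]

theorem continuous_decode [Finite G] [TopologicalSpace G] (hθ : Coding E φ τ n θ T) (f : F) :
    Continuous (decode E τ θ f) := by
  obtain ⟨r, hr⟩ := hθ.exists_window
  refine continuous_pi fun i => IsLocallyConstant.continuous <|
    isLocallyConstant_of_window (Finset.Icc (i - r) (i + r)) fun x y hxy =>
      hθ.decode_eq_of_window hr fun j h0 h1 => hxy j (Finset.mem_Icc.2 ⟨h0, h1⟩)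

theorem measurable_decode [Finite G] [MeasurableSpace G] [MeasurableSingletonClass G]
    [Countable F] [MeasurableSpace F] [MeasurableSingletonClass F] (hθ : Coding E φ τ n θ T) :
    Measurable fun p : F × (ℤ → Fin n) => decode E τ θ p.1 p.2 := by
  let _ : TopologicalSpace G := ⊥
  have _ : DiscreteTopology G := ⟨rfl⟩
  exact measurable_from_prod_countable_right fun f => (hθ.continuous_decode f).measurable

/-- A local character which sees the homoclinic group has zero mean on each fibre. -/
theorem integral_addChar_decode_eq_zero [Finite G] [NeZero n] (hθ : Coding E φ τ n θ T)
    {χ : AddChar (ℤ → G) ℂ} (hχ : IsLocal χ) {h : ℤ → G} (hh : h ∈ homoclinicGroup E)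
    (hne : χ h ≠ 1) (f : F) : ∫ y, χ (decode E τ θ f y) ∂bernoulli n = 0 := by
  let _ : TopologicalSpace G := ⊥
  have _ : DiscreteTopology G := ⟨rfl⟩
  have hcont : Continuous fun y => χ (decode E τ θ f y) :=
    (continuous_of_isLocal hχ).comp (hθ.continuous_decode f)
  obtain ⟨hd, M, hM⟩ := id hh
  have hmem : ∀ y, decode E τ θ f y + h ∈ TMC E := fun y => add_mem_TMC (hθ.decode_mem f y) hd
  have hout : ∀ y i, i ∉ Finset.Ico (-M : ℤ) M →
      (decode E τ θ f y + h) i = decode E τ θ f y i := by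
    intro y i hi
    have : h i = 0 := by
      by_contra h0
      exact hi (Finset.mem_Ico.2 (hM i h0))
    rw [Pi.add_apply, this, add_zero]
  have hval : ∀ y i, θ (decode E τ θ f y i) = ident τ f y i := fun y i =>
    congrFun (hθ.comp_decode f y) i
  let U : (ℤ → Fin n) → ℤ → Fin n := fun y i => (θ ((decode E τ θ f y + h) i)).2
  have hdecode : ∀ y, decode E τ θ f (U y) = decode E τ θ f y + h := by
    intro y
    have h1 : (θ ((decode E τ θ f y + h) 0)).1 = f := by
      have h2 := fst_eq_of_mem_hTMC (hθ.bijOn.mapsTo (hmem y)) (M : ℤ)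
      simp only [Function.comp] at h2
      rw [hout y M (by simp), hval] at h2
      exact ((τ ^ (M : ℤ)).injective h2).symm
    have := hθ.decode_comp (hmem y)
    rwa [h1] at this
  refine integral_bernoulli_eq_zero n ?_ (U := U) (fun y y' hy => ?_) (Finset.Ico (-M : ℤ) M)
    (fun y i hi => ?_) hne fun y => ?_
  · exact hcont.integrable_of_hasCompactSupport (HasCompactSupport.of_compactSpace _)
  · have := congrArg (decode E τ θ f) hy
    rw [hdecode, hdecode] at this
    exact (hθ.decode_injective (add_right_cancel this)).2
  · simp only [U, hout y i hi, hval, ident]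
  · rw [hdecode, χ.map_add_eq_mul, mul_comm]

/-- A local character which is trivial on the homoclinic group is constant on each fibre. -/
theorem addChar_decode_eq [Finite G] {η ρ : G ≃+ G} (hθ : Coding E φ τ n θ T)
    (hA : AffineChain E η ρ) {χ : AddChar (ℤ → G) ℂ} (hχ : IsLocal χ)
    (htriv : ∀ h ∈ homoclinicGroup E, χ h = 1) (f : F) (y y' : ℤ → Fin n) :
    χ (decode E τ θ f y) = χ (decode E τ θ f y') := by
  obtain ⟨r, hr⟩ := hθ.exists_window
  obtain ⟨M, hM⟩ := hχ
  let y'' : ℤ → Fin n := fun i => if -((M + r : ℕ) : ℤ) ≤ i ∧ i < (M + r : ℕ) then y i else y' i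
  have h1 : χ (decode E τ θ f y - decode E τ θ f y'') = 1 := hM _ fun i h0 h1 => by
    refine sub_eq_zero.2 (hθ.decode_eq_of_window hr fun j h2 h3 => ?_)
    simp only [y'']
    rw [if_pos (by push_cast; omega)]
  have h2 : χ (decode E τ θ f y'' - decode E τ θ f y') = 1 := by
    refine htriv _ ⟨hA.sub_mem _ (hθ.decode_mem f y'') _ (hθ.decode_mem f y'),
      M + 2 * r + 1, fun i hi => ?_⟩
    by_contra hcon
    refine hi (sub_eq_zero.2 (hθ.decode_eq_of_window hr fun j h2 h3 => ?_))
    simp only [y'']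
    rw [if_neg (by push_cast at hcon ⊢; omega)]
  rw [show decode E τ θ f y = (decode E τ θ f y - decode E τ θ f y'')
    + ((decode E τ θ f y'' - decode E τ θ f y') + decode E τ θ f y') by abel,
    χ.map_add_eq_mul, χ.map_add_eq_mul, h1, h2, one_mul, one_mul]

end Decode
end Coding

section CesaroLimits

theorem CesaroNull.tendsto {f : ℕ → ℝ} (hf : CesaroNull f) (hf0 : ∀ m, 0 ≤ f m) :
    Tendsto (fun N : ℕ => (N : ℝ)⁻¹ * ∑ m ∈ Finset.range N, f m) atTop (𝓝 0) := by
  rw [Metric.tendsto_atTop]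
  intro ε hε
  obtain ⟨C, hC⟩ := hf (ε / 2) (half_pos hε)
  obtain ⟨N₀, hN₀⟩ := exists_nat_gt (2 * C / ε)
  refine ⟨N₀ + 1, fun N hN => ?_⟩
  have hN0 : (0 : ℝ) < N := by exact_mod_cast (by omega : 0 < N)
  have hNN : (N₀ : ℝ) < N := by exact_mod_cast (by omega : N₀ < N)
  rw [Real.dist_eq, sub_zero, abs_of_nonneg
    (mul_nonneg (by positivity) (Finset.sum_nonneg fun m _ => hf0 m)), inv_mul_lt_iff₀ hN0]
  have h1 := hN₀.trans hNN
  rw [div_lt_iff₀ hε] at h1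
  nlinarith [hC N]

theorem tendsto_cesaro_of_norm {u : ℕ → ℂ} (hu : CesaroNull fun m => ‖u m‖) :
    Tendsto (fun N : ℕ => (N : ℂ)⁻¹ * ∑ m ∈ Finset.range N, u m) atTop (𝓝 0) := by
  refine squeeze_zero_norm (fun N => ?_) (hu.tendsto fun m => norm_nonneg _)
  rw [norm_mul, norm_inv, Complex.norm_natCast]
  exact mul_le_mul_of_nonneg_left (norm_sum_le _ _) (by positivity)

/-- The Cesàro means of an eventually periodic sequence converge to the mean over a period. -/
theorem tendsto_cesaro_of_periodic {u : ℕ → ℂ} {s P : ℕ} (hP : 1 ≤ P)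
    (hu : ∀ m, s ≤ m → u (m + P) = u m) :
    Tendsto (fun N : ℕ => (N : ℂ)⁻¹ * ∑ m ∈ Finset.range N, u m) atTop
      (𝓝 ((P : ℂ)⁻¹ * ∑ i ∈ Finset.range P, u (s + i))) := by
  set w := (P : ℂ)⁻¹ * ∑ i ∈ Finset.range P, u (s + i) with hw
  have hP0 : (P : ℂ) ≠ 0 := by exact_mod_cast (by omega : P ≠ 0)
  let S : ℕ → ℂ := fun N => ∑ m ∈ Finset.range N, (u m - w)
  have hS : ∀ N, s ≤ N → S (N + P) = S N := by
    intro N hN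
    induction N, hN using Nat.le_induction with
    | base =>
      simp only [S, Finset.sum_range_add, Finset.sum_sub_distrib (f := fun x => u (s + x)),
        Finset.sum_const, Finset.card_range, nsmul_eq_mul, hw]
      rw [mul_inv_cancel_left₀ hP0, sub_self, add_zero]
    | succ N hN ih =>
      simp only [S] at ih ⊢
      rw [add_right_comm, Finset.sum_range_succ, ih, Finset.sum_range_succ, hu N hN]
  obtain ⟨C, hC⟩ : ∃ C : ℝ, ∀ N, ‖S N‖ ≤ C := by
    refine ⟨∑ j ∈ Finset.range (s + P), ‖S j‖, fun N => ?_⟩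
    induction N using Nat.strong_induction_on with
    | _ N ih =>
      by_cases hN : N < s + P
      · exact Finset.single_le_sum (f := fun j => ‖S j‖) (fun j _ => norm_nonneg _)
          (Finset.mem_range.2 hN)
      · have := hS (N - P) (by omega)
        rw [Nat.sub_add_cancel (by omega)] at this
        rw [this]
        exact ih _ (by omega)
  have h0 : Tendsto (fun N : ℕ => (N : ℂ)⁻¹ * S N) atTop (𝓝 0) := by
    refine squeeze_zero_norm (a := fun N : ℕ => (N : ℝ)⁻¹ * C) (fun N => ?_) ?_
    · rw [norm_mul, norm_inv, Complex.norm_natCast]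
      exact mul_le_mul_of_nonneg_left (hC N) (by positivity)
    · simpa using (tendsto_inv_atTop_nhds_zero_nat (𝕜 := ℝ)).mul_const C
  have h1 := h0.add_const w
  rw [zero_add] at h1
  refine h1.congr' ?_
  filter_upwards [eventually_ge_atTop 1] with N hN
  have hN0 : (N : ℂ) ≠ 0 := by exact_mod_cast (by omega : N ≠ 0)
  simp only [S, Finset.sum_sub_distrib (f := u), Finset.sum_const, Finset.card_range, nsmul_eq_mul]
  rw [mul_sub, inv_mul_cancel_left₀ hN0, sub_add_cancel]

theorem exists_iterate_periodic {F : Type*} [Finite F] (T : F → F) :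
    ∃ s P : ℕ, 1 ≤ P ∧ ∀ m, s ≤ m → T^[m + P] = T^[m] := by
  obtain ⟨a, b, hab, h⟩ := Finite.exists_ne_map_eq_of_infinite fun m : ℕ => T^[m]
  wlog hlt : a < b generalizing a b
  · exact this b a hab.symm h.symm (by omega)
  refine ⟨a, b - a, by omega, fun m hm => ?_⟩
  rw [show m + (b - a) = (m - a) + b by omega, Function.iterate_add, ← h, ← Function.iterate_add,
    Nat.sub_add_cancel hm]

/-- The average of the images of `μ` under `P` consecutive iterates of `T`. -/
noncomputable def orbitMean {F : Type*} [MeasurableSpace F] (T : F → F) (s P : ℕ)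
    (μ : Measure F) : Measure F :=
  (P : ℝ≥0∞)⁻¹ • ∑ i ∈ Finset.range P, μ.map T^[s + i]

section OrbitMean
variable {F : Type*} [MeasurableSpace F] {T : F → F} {s P : ℕ} {μ : Measure F}

theorem isProbabilityMeasure_orbitMean [IsProbabilityMeasure μ] (hT : Measurable T) (hP : 1 ≤ P) :
    IsProbabilityMeasure (orbitMean T s P μ) := by
  refine ⟨?_⟩
  have h : ∀ i, μ.map T^[s + i] Set.univ = 1 := fun i => by
    rw [Measure.map_apply (hT.iterate _) MeasurableSet.univ, Set.preimage_univ, measure_univ]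
  rw [orbitMean, Measure.smul_apply, Measure.finsetSum_apply]
  simp only [h, Finset.sum_const, Finset.card_range, nsmul_eq_mul, mul_one, smul_eq_mul]
  exact ENNReal.inv_mul_cancel (by exact_mod_cast (by omega : P ≠ 0)) (ENNReal.natCast_ne_top P)

theorem map_orbitMean (hT : Measurable T) (h : T^[s + P] = T^[s]) :
    (orbitMean T s P μ).map T = orbitMean T s P μ := by
  rw [orbitMean, Measure.map_smul]
  congr 1
  have h1 : (∑ i ∈ Finset.range P, μ.map T^[s + i]).map T
      = ∑ i ∈ Finset.range P, μ.map T^[s + (i + 1)] := by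
    rw [← Measure.mapₗ_apply_of_measurable hT, map_sum]
    refine Finset.sum_congr rfl fun i _ => ?_
    rw [Measure.mapₗ_apply_of_measurable hT, Measure.map_map hT (hT.iterate _),
      ← Function.iterate_succ']
    rfl
  rw [h1]
  cases P with
  | zero => rfl
  | succ P =>
    rw [Finset.sum_range_succ, Finset.sum_range_succ', h, add_zero]

theorem integral_orbitMean [Finite F] [MeasurableSingletonClass F] [IsFiniteMeasure μ] (v : F → ℂ) :
    ∫ f, v f ∂orbitMean T s P μ
      = (P : ℂ)⁻¹ * ∑ i ∈ Finset.range P, ∫ f, v (T^[s + i] f) ∂μ := by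
  rw [orbitMean, integral_smul_measure, integral_finsetSum_measure fun i _ => Integrable.of_finite]
  simp only [ENNReal.toReal_inv, ENNReal.toReal_natCast, Complex.real_smul, Complex.ofReal_inv,
    Complex.ofReal_natCast]
  congr 1
  refine Finset.sum_congr rfl fun i _ => ?_
  rw [integral_map (Measurable.of_discrete).aemeasurable
    (Integrable.of_finite (f := v)).aestronglyMeasurable]

end OrbitMean

section Density
variable {X : Type*} [TopologicalSpace X] [CompactSpace X] [MeasurableSpace X]
  [OpensMeasurableSpace X]

theorem integrable_continuousMap_comp (μ : Measure X) [IsFiniteMeasure μ] (f : C(X, ℂ)) {Ψ : X → X}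
    (hΨ : Continuous Ψ) : Integrable (fun x => f (Ψ x)) μ :=
  (f.continuous.comp hΨ).integrable_of_hasCompactSupport (HasCompactSupport.of_compactSpace _)

/-- The functions whose Cesàro means converge to the mean with respect to `κ`. -/
def cesaroGood (μ : Measure X) [IsFiniteMeasure μ] (Φ : C(X, X)) (κ : Measure X)
    [IsFiniteMeasure κ] : Submodule ℂ C(X, ℂ) where
  carrier := {f | Tendsto (fun N : ℕ => (N : ℂ)⁻¹ * ∑ m ∈ Finset.range N, ∫ x, f (Φ^[m] x) ∂μ)
    atTop (𝓝 (∫ x, f x ∂κ))}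
  zero_mem' := by simp
  add_mem' {f g} hf hg := by
    have hi := fun (f : C(X, ℂ)) m => integrable_continuousMap_comp μ f (Φ.continuous.iterate m)
    have hk : ∀ f : C(X, ℂ), Integrable (fun x => f x) κ := fun f =>
      integrable_continuousMap_comp κ f continuous_id
    have := Tendsto.add hf hg
    simp only [Set.mem_ofPred_eq, ContinuousMap.add_apply]
    rw [integral_add (hk f) (hk g)]
    refine this.congr fun N => ?_
    rw [← mul_add, ← Finset.sum_add_distrib]
    congr 1
    exact Finset.sum_congr rfl fun m _ => (integral_add (hi f m) (hi g m)).symm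
  smul_mem' a f hf := by
    have := Tendsto.const_mul a hf
    simp only [Set.mem_ofPred_eq, ContinuousMap.smul_apply, smul_eq_mul, integral_const_mul]
    refine this.congr fun N => ?_
    rw [← Finset.mul_sum]
    ring

theorem mem_cesaroGood_of_mem_closure {μ : Measure X} [IsProbabilityMeasure μ] {Φ : C(X, X)}
    {κ : Measure X} [IsProbabilityMeasure κ] {f : C(X, ℂ)}
    (hf : f ∈ closure (cesaroGood μ Φ κ : Set C(X, ℂ))) : f ∈ cesaroGood μ Φ κ := by
  have hi := fun (f : C(X, ℂ)) m => integrable_continuousMap_comp μ f (Φ.continuous.iterate m)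
  have hk : ∀ f : C(X, ℂ), Integrable (fun x => f x) κ := fun f =>
      integrable_continuousMap_comp κ f continuous_id
  refine Metric.tendsto_atTop.2 fun ε hε => ?_
  obtain ⟨g, hg, hfg⟩ := Metric.mem_closure_iff.1 hf (ε / 3) (by positivity)
  obtain ⟨N₀, hN₀⟩ := Metric.tendsto_atTop.1 hg (ε / 3) (by positivity)
  have hpt : ∀ x, ‖f x - g x‖ ≤ ε / 3 := fun x => by
    rw [← dist_eq_norm]
    exact (ContinuousMap.dist_apply_le_dist x).trans hfg.le
  refine ⟨N₀, fun N hN => ?_⟩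
  have h1 : dist (∫ x, f x ∂κ) (∫ x, g x ∂κ) ≤ ε / 3 := by
    rw [dist_eq_norm, ← integral_sub (hk f) (hk g)]
    simpa using norm_integral_le_of_norm_le_const (μ := κ) (Eventually.of_forall fun x => hpt x)
  have h2 : dist ((N : ℂ)⁻¹ * ∑ m ∈ Finset.range N, ∫ x, f (Φ^[m] x) ∂μ)
      ((N : ℂ)⁻¹ * ∑ m ∈ Finset.range N, ∫ x, g (Φ^[m] x) ∂μ) ≤ ε / 3 := by
    rw [dist_eq_norm, ← mul_sub, ← Finset.sum_sub_distrib, norm_mul, norm_inv,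
      Complex.norm_natCast]
    have hb : ‖∑ m ∈ Finset.range N, (∫ x, f (Φ^[m] x) ∂μ - ∫ x, g (Φ^[m] x) ∂μ)‖
        ≤ N * (ε / 3) := by
      refine (norm_sum_le_of_le _ (f := fun m => ∫ x, f (Φ^[m] x) ∂μ - ∫ x, g (Φ^[m] x) ∂μ)
        (n := fun _ => ε / 3) fun m _ => ?_).trans_eq (by simp)
      rw [← integral_sub (hi f m) (hi g m)]
      simpa using norm_integral_le_of_norm_le_const (μ := μ)
        (Eventually.of_forall fun x => hpt (Φ^[m] x))
    rcases Nat.eq_zero_or_pos N with rfl | hpos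
    · simp; positivity
    · rw [inv_mul_le_iff₀ (by exact_mod_cast hpos)]
      exact hb
  have h3 := hN₀ N hN
  have := dist_triangle4 ((N : ℂ)⁻¹ * ∑ m ∈ Finset.range N, ∫ x, f (Φ^[m] x) ∂μ)
    ((N : ℂ)⁻¹ * ∑ m ∈ Finset.range N, ∫ x, g (Φ^[m] x) ∂μ) (∫ x, g x ∂κ) (∫ x, f x ∂κ)
  rw [dist_comm (∫ x, g x ∂κ)] at this
  linarith

/-- It suffices to verify convergence of Cesàro means on a self-adjoint monoid of functions
separating points. -/
theorem cesaroGood_eq_top {μ : Measure X} [IsProbabilityMeasure μ] {Φ : C(X, X)}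
    {κ : Measure X} [IsProbabilityMeasure κ] (S : Submonoid C(X, ℂ)) (hstar : ∀ f ∈ S, star f ∈ S)
    (hsep : ∀ x y, x ≠ y → ∃ f ∈ S, f x ≠ f y) (hS : ∀ f ∈ S, f ∈ cesaroGood μ Φ κ)
    (f : C(X, ℂ)) : f ∈ cesaroGood μ Φ κ := by
  let A : StarSubalgebra ℂ C(X, ℂ) :=
    { Algebra.adjoin ℂ (S : Set C(X, ℂ)) with
      star_mem' := fun {a} ha => by
        change a ∈ Algebra.adjoin ℂ (S : Set C(X, ℂ)) at ha
        change star a ∈ Algebra.adjoin ℂ (S : Set C(X, ℂ))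
        induction ha using Algebra.adjoin_induction with
        | mem x hx => exact Algebra.subset_adjoin (hstar x hx)
        | algebraMap r =>
          rw [← algebraMap_star_comm]
          exact Subalgebra.algebraMap_mem _ _
        | add x y _ _ hx hy => rw [star_add]; exact Subalgebra.add_mem _ hx hy
        | mul x y _ _ hx hy => rw [star_mul]; exact Subalgebra.mul_mem _ hy hx }
  have hA : (A : Set C(X, ℂ)) ⊆ cesaroGood μ Φ κ := by
    intro g hg
    have hg' : g ∈ Subalgebra.toSubmodule (Algebra.adjoin ℂ (S : Set C(X, ℂ))) := hg
    rw [Algebra.adjoin_eq_span, Submonoid.closure_eq] at hg'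
    exact Submodule.span_le.2 hS hg'
  have hAsep : A.SeparatesPoints := fun x y hxy => by
    obtain ⟨g, hg, hne⟩ := hsep x y hxy
    exact ⟨g, ⟨g, Algebra.subset_adjoin hg, rfl⟩, hne⟩
  have htop := ContinuousMap.starSubalgebra_topologicalClosure_eq_top_of_separatesPoints A hAsep
  have hf : f ∈ closure (A : Set C(X, ℂ)) := by
    rw [← StarSubalgebra.topologicalClosure_coe, htop]
    trivial
  exact mem_cesaroGood_of_mem_closure (closure_mono hA hf)

end Density
end CesaroLimits

section LocalCharacters
variable (G : Type*) [AddCommGroup G] [TopologicalSpace G]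

/-- The local characters, as continuous functions. -/
def localCharacters : Submonoid C(ℤ → G, ℂ) where
  carrier := {f | ∃ χ : AddChar (ℤ → G) ℂ, IsLocal χ ∧ ⇑f = χ}
  one_mem' := ⟨1, ⟨0, fun _ _ => rfl⟩, rfl⟩
  mul_mem' := by
    rintro f g ⟨χ, ⟨M, hM⟩, hf⟩ ⟨χ', ⟨M', hM'⟩, hg⟩
    refine ⟨χ * χ', ⟨max M M', fun x hx => ?_⟩, by ext x; simp [hf, hg]⟩
    rw [AddChar.mul_apply, hM x fun i h0 h1 => hx i (by grind) (by grind),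
      hM' x fun i h0 h1 => hx i (by grind) (by grind), one_mul]

variable {G}

theorem star_mem_localCharacters [Finite G] {f : C(ℤ → G, ℂ)} (hf : f ∈ localCharacters G) :
    star f ∈ localCharacters G := by
  obtain ⟨χ, ⟨M, hM⟩, hf⟩ := hf
  refine ⟨χ⁻¹, ⟨M, fun x hx => ?_⟩, ?_⟩
  · rw [AddChar.inv_apply]
    exact hM _ fun i h0 h1 => by rw [Pi.neg_apply, hx i h0 h1, neg_zero]
  · funext x
    rw [ContinuousMap.star_apply, hf, AddChar.inv_apply, AddChar.map_neg_eq_inv,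
      Complex.inv_eq_conj (norm_addChar_eq_one χ x)]
    rfl

theorem localCharacters_separate [Finite G] [DiscreteTopology G] {x y : ℤ → G} (hxy : x ≠ y) :
    ∃ f ∈ localCharacters G, f x ≠ f y := by
  obtain ⟨i, hi⟩ := Function.ne_iff.1 hxy
  obtain ⟨ψ, hψ⟩ := AddChar.exists_apply_ne_zero.2 (sub_ne_zero.2 hi)
  let χ : AddChar (ℤ → G) ℂ := ψ.compAddMonoidHom (Pi.evalAddMonoidHom (fun _ => G) i)
  have hχ : IsLocal χ := ⟨i.natAbs + 1, fun z hz => by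
    change ψ (z i) = 1
    rw [hz i (by omega) (by omega), AddChar.map_zero_eq_one]⟩
  refine ⟨⟨χ, continuous_of_isLocal hχ⟩, ⟨χ, hχ, rfl⟩, fun h => hψ ?_⟩
  change ψ (x i) = ψ (y i) at h
  have hne : ψ (y i) ≠ 0 := fun h0 => by
    have := norm_addChar_eq_one χ y
    rw [show χ y = ψ (y i) from rfl, h0, norm_zero] at this
    exact zero_ne_one this
  rw [AddChar.map_sub_eq_div, h, div_self hne]

end LocalCharacters

section Limit
variable {G F : Type*} [Fintype G] [AddCommGroup G] [MeasurableSpace G]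
  [MeasurableSingletonClass G] [Finite F] [MeasurableSpace F] [MeasurableSingletonClass F]
  {n : ℕ} {τ : Equiv.Perm F} {E : Set (G × G)} {φ : G → G → G} {θ : G → F × Fin n}
  {T : F → F} {s P : ℕ}

/-- The image under `decode` of the product of a measure on `F` with the Bernoulli measure. -/
noncomputable def limitMeasure (E : Set (G × G)) (τ : Equiv.Perm F) (θ : G → F × Fin n)
    (μF : Measure F) : Measure (ℤ → G) :=
  (μF.prod (bernoulli n)).map fun p => decode E τ θ p.1 p.2

namespace Coding
variable {η ρ : G ≃+ G} {c : G} {μ : Measure (ℤ → G)} {μF : Measure F}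

theorem map_limitMeasure (hθ : Coding E φ τ n θ T) :
    (limitMeasure E τ θ μF).map (fun x => θ ∘ x)
      = (μF.prod (bernoulli n)).map fun p => ident τ p.1 p.2 := by
  have hm : Measurable fun x : ℤ → G => θ ∘ x :=
    measurable_pi_lambda _ fun i => Measurable.of_discrete.comp (measurable_pi_apply i)
  rw [limitMeasure, Measure.map_map hm hθ.measurable_decode]
  congr 1
  exact funext fun p => hθ.comp_decode p.1 p.2

/-- A local character that is trivial on the homoclinic group is read off the first
component. -/
theorem integral_iterate_of_trivial (hθ : Coding E φ τ n θ T) (hg : GoodMeasure E μ)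
    (hA : AffineChain E η ρ) {χ : AddChar (ℤ → G) ℂ} (hχ : IsLocal χ)
    (htriv : ∀ h ∈ homoclinicGroup E, χ h = 1) (y : ℤ → Fin n) (m : ℕ) :
    ∫ x, χ ((CA φ)^[m] x) ∂μ
      = ∫ a, χ (decode E τ θ (T^[m] a) y) ∂μ.map fun x => (θ (x 0)).1 := by
  have := hg.1
  have hcl : Measurable fun x : ℤ → G => (θ (x 0)).1 :=
    (Measurable.of_discrete (f := fun a => (θ a).1)).comp (measurable_pi_apply 0)
  have := Measure.isProbabilityMeasure_map (μ := μ) hcl.aemeasurable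
  rw [integral_map hcl.aemeasurable
    (Integrable.of_finite (f := fun a => χ (decode E τ θ (T^[m] a) y))).aestronglyMeasurable]
  refine integral_congr_ae ?_
  filter_upwards [ae_mem_TMC hg] with x hx
  conv_lhs => rw [← hθ.decode_comp (hθ.iterate_mem hx m)]
  rw [hθ.iterate_step hx m]
  exact hθ.addChar_decode_eq hA hχ htriv _ _ _

variable [NeZero n] [IsProbabilityMeasure μF]

theorem isProbabilityMeasure_limitMeasure (hθ : Coding E φ τ n θ T) :
    IsProbabilityMeasure (limitMeasure E τ θ μF) :=
  Measure.isProbabilityMeasure_map hθ.measurable_decode.aemeasurable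

theorem limitMeasure_TMC (hθ : Coding E φ τ n θ T) : limitMeasure E τ θ μF (TMC E) = 1 := by
  let _ : TopologicalSpace G := ⊥
  have _ : DiscreteTopology G := ⟨rfl⟩
  rw [limitMeasure, Measure.map_apply hθ.measurable_decode (isClosed_TMC E).measurableSet]
  have : (fun p : F × (ℤ → Fin n) => decode E τ θ p.1 p.2) ⁻¹' TMC E = Set.univ :=
    Set.eq_univ_of_forall fun p => hθ.decode_mem p.1 p.2
  rw [this, measure_univ]

variable [TopologicalSpace G] [DiscreteTopology G]

theorem integral_limitMeasure (hθ : Coding E φ τ n θ T) (f : C(ℤ → G, ℂ)) :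
    ∫ x, f x ∂limitMeasure E τ θ μF
      = ∫ a, ∫ y, f (decode E τ θ a y) ∂bernoulli n ∂μF := by
  have := hθ.isProbabilityMeasure_limitMeasure (μF := μF)
  have hi : Integrable f (limitMeasure E τ θ μF) :=
    integrable_continuousMap_comp _ f continuous_id
  rw [limitMeasure] at hi ⊢
  rw [integral_map hθ.measurable_decode.aemeasurable hi.aestronglyMeasurable]
  exact integral_prod _ ((integrable_map_measure hi.aestronglyMeasurable
    hθ.measurable_decode.aemeasurable).1 hi)

/-- The Cesàro means of a local character that sees the homoclinic group tend to zero. -/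
theorem mem_cesaroGood_of_nontrivial (hθ : Coding E φ τ n θ T) (hg : GoodMeasure E μ)
    (hc : CCSD E μ) (hA : AffineChain E η ρ) (hcomm : ∀ a, η (ρ a) = ρ (η a))
    (hφ : ∀ a b, φ a b = η a + ρ b + c) [IsProbabilityMeasure μ]
    [IsProbabilityMeasure (limitMeasure E τ θ μF)]
    {f : C(ℤ → G, ℂ)} {χ : AddChar (ℤ → G) ℂ} (hχ : IsLocal χ) (hf : ⇑f = χ)
    (hne : ∃ h ∈ homoclinicGroup E, χ h ≠ 1) :
    f ∈ cesaroGood μ ⟨CA φ, continuous_CA φ⟩ (limitMeasure E τ θ μF) := by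
  change Tendsto _ _ (𝓝 _)
  obtain ⟨h, hh, hne'⟩ := hne
  rw [hθ.integral_limitMeasure]
  simp only [hf, ContinuousMap.coe_mk, hθ.integral_addChar_decode_eq_zero hχ hh hne',
    integral_zero]
  exact tendsto_cesaro_of_norm (cesaroNull_of_isLocal hg hc hA hcomm hφ hχ ⟨h, hh, hne'⟩)

theorem mem_cesaroGood_of_trivial (hθ : Coding E φ τ n θ T) (hg : GoodMeasure E μ)
    (hA : AffineChain E η ρ) [IsProbabilityMeasure μ] (hP : 1 ≤ P)
    (hT : ∀ m, s ≤ m → T^[m + P] = T^[m])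
    [IsProbabilityMeasure (orbitMean T s P (μ.map fun x => (θ (x 0)).1))]
    [IsProbabilityMeasure
      (limitMeasure E τ θ (orbitMean T s P (μ.map fun x => (θ (x 0)).1)))]
    {f : C(ℤ → G, ℂ)} {χ : AddChar (ℤ → G) ℂ} (hχ : IsLocal χ) (hf : ⇑f = χ)
    (htriv : ∀ h ∈ homoclinicGroup E, χ h = 1) :
    f ∈ cesaroGood μ ⟨CA φ, continuous_CA φ⟩
      (limitMeasure E τ θ (orbitMean T s P (μ.map fun x => (θ (x 0)).1))) := by
  change Tendsto _ _ (𝓝 _)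
  have hconst : ∀ a y, χ (decode E τ θ a y) = χ (decode E τ θ a 0) := fun a y =>
    hθ.addChar_decode_eq hA hχ htriv a y 0
  have hint := hθ.integral_iterate_of_trivial hg hA hχ htriv 0
  rw [hθ.integral_limitMeasure]
  simp only [hf, ContinuousMap.coe_mk, hconst, integral_const, probReal_univ, one_smul]
  rw [integral_orbitMean fun a => χ (decode E τ θ a 0)]
  simp only [hint]
  exact tendsto_cesaro_of_periodic hP fun m hm => by rw [hT m hm]

end Coding
end Limit

/-- Convergence of Cesàro means of complex functions gives that of real functions. -/
theorem cesaroTendstoTo_of_cesaroGood {G : Type*} [Finite G] [TopologicalSpace G]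
    [DiscreteTopology G] [MeasurableSpace G] [MeasurableSingletonClass G] {φ : G → G → G}
    {μ κ : Measure (ℤ → G)} [IsProbabilityMeasure μ] [IsProbabilityMeasure κ]
    (h : ∀ f : C(ℤ → G, ℂ), f ∈ cesaroGood μ ⟨CA φ, continuous_CA φ⟩ κ) :
    CesaroTendstoTo μ (CA φ) κ := by
  intro f
  have := h ⟨fun x => (f x : ℂ), Complex.continuous_ofReal.comp f.continuous⟩
  change Tendsto _ _ (𝓝 _) at this
  simp only [ContinuousMap.coe_mk, integral_complex_ofReal] at this
  refine (Complex.continuous_re.tendsto _).comp this |>.congr fun N => ?_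
  rw [Function.comp_apply, ← Complex.ofReal_sum, ← Complex.ofReal_natCast, ← Complex.ofReal_inv,
    ← Complex.ofReal_mul, Complex.ofReal_re]

end CAProof

/-- Theorem (i): Cesàro mean convergence for regular simple SC affine c.a.,
with limit the pushforward of `μ_𝔽 × ν`, `ν` the uniform Bernoulli measure on `Σ_n`. -/
theorem CAStmt.stmt14 {G : Type} [Fintype G] [AddCommGroup G]
    [TopologicalSpace G] [DiscreteTopology G]
    [MeasurableSpace G] [MeasurableSingletonClass G]
    {F : Type} [Fintype F] [MeasurableSpace F] [MeasurableSingletonClass F]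
    (E : Set (G × G)) (hE : EveryLetterOccurs E)
    (φ : G → G → G) (hSC : SC E φ)
    (η ρa : G ≃+ G) (hcomm : ∀ a, η (ρa a) = ρa (η a)) (c : G)
    (hφ : ∀ a b, φ a b = η a + ρa b + c)
    (τ : Equiv.Perm F) (n k : ℕ)
    (op : (ℤ → F × Fin n) → (ℤ → F × Fin n) → (ℤ → F × Fin n))
    (θ : G → F × Fin n) (oF : F → F → F) (oS : Fin n → Fin n → Fin n)
    (hRS : RegularSimpleData E φ τ n k op θ oF oS)
    (μ : Measure (ℤ → G)) (hgood : GoodMeasure E μ) (hccsd : CCSD E μ) :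
    ∃ (μF : Measure F) (ν : Measure (ℤ → Fin n)) (κ : Measure (ℤ → G)),
      IsProbabilityMeasure μF ∧
      Measure.map (fun f : F => oF f (τ f)) μF = μF ∧
      IsProbabilityMeasure ν ∧
      (∀ (m : ℕ) (w : Fin m → Fin n) (j : ℤ),
        ν {y : ℤ → Fin n | ∀ i : Fin m, y (j + ((i : ℕ) : ℤ)) = w i}
          = ((n : ℝ≥0∞))⁻¹ ^ m) ∧
      IsProbabilityMeasure κ ∧ κ (TMC E) = 1 ∧
      Measure.map (fun x : ℤ → G => θ ∘ x) κ
        = Measure.map (fun fy : F × (ℤ → Fin n) => ident τ fy.1 fy.2) (μF.prod ν) ∧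
      CesaroTendstoTo μ (CA φ) κ := by
  have hne : E.Nonempty := by
    rw [Set.nonempty_iff_ne_empty]
    rintro rfl
    have h0 : TMC (∅ : Set (G × G)) = ∅ := Set.eq_empty_of_forall_notMem fun x hx => hx 0
    have := hgood.2.2.1
    rw [h0, measure_empty] at this
    exact zero_ne_one this
  have : NeZero n := ⟨by have := hRS.1; omega⟩
  have hθ := CAProof.coding_of_regularSimpleData hSC hRS
  have hA := CAProof.affineChain_of_SC hE hSC hφ hne
  have := hgood.1
  have hT : Measurable fun f : F => oF f (τ f) := Measurable.of_discrete
  obtain ⟨s, P, hP, hper⟩ := CAProof.exists_iterate_periodic fun f : F => oF f (τ f)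
  have hcl : Measurable fun x : ℤ → G => (θ (x 0)).1 :=
    (Measurable.of_discrete (f := fun a => (θ a).1)).comp (measurable_pi_apply 0)
  have := Measure.isProbabilityMeasure_map (μ := μ) hcl.aemeasurable
  have hprob := CAProof.isProbabilityMeasure_orbitMean (s := s)
    (μ := μ.map fun x => (θ (x 0)).1) hT hP
  have := hθ.isProbabilityMeasure_limitMeasure
    (μF := CAProof.orbitMean (fun f : F => oF f (τ f)) s P (μ.map fun x => (θ (x 0)).1))
  refine ⟨_, CAProof.bernoulli n, CAProof.limitMeasure E τ θ _, hprob,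
    CAProof.map_orbitMean hT (hper s le_rfl), inferInstance, CAProof.bernoulli_cylinder n, this,
    hθ.limitMeasure_TMC, hθ.map_limitMeasure, ?_⟩
  refine CAProof.cesaroTendstoTo_of_cesaroGood <|
    CAProof.cesaroGood_eq_top (CAProof.localCharacters G)
      (fun f => CAProof.star_mem_localCharacters)
      (fun x y => CAProof.localCharacters_separate) ?_
  rintro f ⟨χ, hχ, hf⟩
  by_cases h : ∃ h ∈ CAProof.homoclinicGroup E, χ h ≠ 1
  · exact hθ.mem_cesaroGood_of_nontrivial hgood hccsd hA hcomm hφ hχ hf h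
  · push Not at h
    exact hθ.mem_cesaroGood_of_trivial hgood hA hP hper hχ hf h
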